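/- Let F be a separably closed field of characteristic not 2 or 3 and J = J^d the split Albert algebra over F. For a subspace W ⊆ J let Φ(W) := {j ∈ J : ⟨w,j⟩ = 0 for all w ∈ W}. Then: (a) Φ maps the set of 3-dimensional totally singular subspaces bijectively onto itself, and Φ∘Φ is the identity on this set; (b) Φ maps the set of 2-dimensional totally singular subspaces bijectively onto the set of 5-dimensional maximal totally singular subspaces, and Φ maps the latter set bijectively back, these two restrictions of Φ being mutually inverse; (c) Φ maps the set of 1-dimensional totally singular subspaces bijectively onto the set of hyperlines, with Φ(F·d) = d×J for every rank-one d, and Φ restricted to hyperlines is the inverse bijection. In particular, if d and d' are rank-one elements with d×J = d'×J, then F·d = F·d'. -/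

import Mathlib

set_option synthInstance.maxHeartbeats 1000000
set_option maxHeartbeats 1000000

noncomputable section

open scoped TensorProduct

universe u v

structure OctonionAlgebra (F : Type u) [Field F] : Type (max u (v + 1)) where
  C : Type v
  [ringC : NonAssocRing C]
  [modC : Module F C]
  [sccC : SMulCommClass F C C]
  [istC : IsScalarTower F C C]
  n : QuadraticForm F C
  finrank_eq : Module.finrank F C = 8
  nondeg : ∀ x : C, (∀ y : C, QuadraticMap.polar (⇑n) x y = 0) → x = 0
  n_one : n 1 = 1
  n_mul : ∀ x y : C, n (x * y) = n x * n y

attribute [instance] OctonionAlgebra.ringC OctonionAlgebra.modC OctonionAlgebra.sccC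
  OctonionAlgebra.istC

namespace OctonionAlgebra

variable {F : Type u} [Field F] (O : OctonionAlgebra.{u, v} F)

/-- Conjugation `x̄ := n(x,1)•1 - x` (bundled as a linear map; `polarBilin n x 1 = n(x,1)`). -/
def conj : O.C →ₗ[F] O.C :=
  (LinearMap.toSpanSingleton F O.C (1 : O.C)).comp ((QuadraticMap.polarBilin O.n).flip 1)
    - LinearMap.id

lemma conj_apply (x : O.C) :
    O.conj x = QuadraticMap.polar (⇑O.n) x 1 • (1 : O.C) - x := rfl

/-- A split octonion algebra: the norm form is isotropic. -/
def IsSplit : Prop := ∃ x : O.C, x ≠ 0 ∧ O.n x = 0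

end OctonionAlgebra

/-- A reduced Albert algebra `H₃(C,γ)`. -/
structure ReducedAlbert (F : Type u) [Field F] : Type (max u (v + 1)) where
  O : OctonionAlgebra.{u, v} F
  γ : Fin 3 → Fˣ

namespace ReducedAlbert

variable {F : Type u} [Field F] (A : ReducedAlbert.{u, v} F)

/-- The ambient space of 3×3 matrices over the octonion algebra. -/
abbrev M : Type v := Matrix (Fin 3) (Fin 3) A.O.C

/-- The 27-dimensional space `H₃(C,γ)` of `γ`-hermitian matrices:
`x = γ⁻¹ ⬝ (x̄)ᵀ ⬝ γ`, i.e. entrywise `x i j = γᵢ⁻¹ γⱼ • conj (x j i)`. -/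
def J : Submodule F A.M where
  carrier := {x | ∀ i j, x i j = ((A.γ i : F)⁻¹ * (A.γ j : F)) • A.O.conj (x j i)}
  add_mem' := by
    intro a b ha hb i j
    show a i j + b i j = ((A.γ i : F)⁻¹ * (A.γ j : F)) • A.O.conj (a j i + b j i)
    rw [map_add, smul_add, ← ha i j, ← hb i j]
  zero_mem' := by
    intro i j
    show (0 : A.O.C) = ((A.γ i : F)⁻¹ * (A.γ j : F)) • A.O.conj (0 : A.O.C)
    rw [map_zero, smul_zero]
  smul_mem' := by
    intro c a ha i j
    show c • a i j = ((A.γ i : F)⁻¹ * (A.γ j : F)) • A.O.conj (c • a j i)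
    rw [map_smul, smul_comm, ← ha i j]

/-- The Jordan product `x·y := (xy + yx)/2`. -/
def jmul (x y : A.M) : A.M := (2 : F)⁻¹ • (x * y + y * x)

/-- The trace `T(x)`: the sum of the diagonal entries, which for hermitian matrices are
scalars `ε•1`; the scalar `ε` is recovered as `n(ε•1, 1)/2`. -/
def trace (x : A.M) : F := (2 : F)⁻¹ * ∑ i, QuadraticMap.polar (⇑A.O.n) (x i i) 1

/-- The trace bilinear form `T(x,y) := T(x·y)`. -/
def tb (x y : A.M) : F := A.trace (A.jmul x y)

/-- The adjoint `x ^ # = x·x − T(x)·x + ½(T(x)² − T(x,x))·1`, the unique quadratic map such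
that `T(x^#, y)` is the coefficient of `s` in `N(x + s y)`. -/
def sharp (x : A.M) : A.M :=
  A.jmul x x - A.trace x • x + ((2 : F)⁻¹ * (A.trace x ^ 2 - A.tb x x)) • (1 : A.M)

/-- The Freudenthal cross product `x × y := (x+y)^# − x^# − y^#`. -/
def cross (x y : A.M) : A.M := A.sharp (x + y) - A.sharp x - A.sharp y

/-- The cubic norm `N`, defined pointwise on `J` by
`N(x)·1 = x·(x·x) − T(x)·(x·x) + ½(T(x)² − T(x,x))·x`; the scalar is recovered by
applying the trace (which takes value `3` on `1`). -/
def norm (x : A.M) : F :=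
  (3 : F)⁻¹ * A.trace (A.jmul x (A.jmul x x) - A.trace x • A.jmul x x
    + ((2 : F)⁻¹ * (A.trace x ^ 2 - A.tb x x)) • x)

/-- The operator `⟨x,y⟩(j) := ½ (y × (x × j) − T(j,y)·x − ⅓·T(x,y)·j)`. -/
def brok (x y j : A.M) : A.M :=
  (2 : F)⁻¹ • (A.cross y (A.cross x j) - A.tb j y • x - ((3 : F)⁻¹ * A.tb x y) • j)

/-- `A` is the split Albert algebra `H₃(Cᵈ, 1)`. -/
def IsSplitAlbert : Prop := A.O.IsSplit ∧ ∀ i, A.γ i = 1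

/-- A point of `H₃(C,γ)` with coordinates `(ε₀,ε₁,ε₂; a,b,c)`. -/
def elt (ε : Fin 3 → F) (a b c : A.O.C) : A.M :=
  Matrix.of
    ![![ε 0 • (1 : A.O.C), c, ((A.γ 0 : F)⁻¹ * (A.γ 2 : F)) • A.O.conj b],
      ![((A.γ 1 : F)⁻¹ * (A.γ 0 : F)) • A.O.conj c, ε 1 • (1 : A.O.C), a],
      ![b, ((A.γ 2 : F)⁻¹ * (A.γ 1 : F)) • A.O.conj a, ε 2 • (1 : A.O.C)]]

/-! ### The Brown algebra `B(J, F×F, ζ)` -/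

/-- Ambient space of the Brown algebra `B(J, F×F, ζ)`: elements `(α, j; j', β)`. -/
abbrev Bam : Type (max u v) := F × A.M × A.M × F

/-- The underlying 56-dimensional space of `B(J, F×F, ζ)`: both middle components lie in `J`. -/
def Bsub : Submodule F A.Bam where
  carrier := {p | p.2.1 ∈ A.J ∧ p.2.2.1 ∈ A.J}
  add_mem' := fun ha hb => ⟨A.J.add_mem ha.1 hb.1, A.J.add_mem ha.2 hb.2⟩
  zero_mem' := ⟨A.J.zero_mem, A.J.zero_mem⟩
  smul_mem' := fun c _ h => ⟨A.J.smul_mem c h.1, A.J.smul_mem c h.2⟩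

/-- The product of `B(J, F×F, ζ)`. -/
def bmul (ζ : F) (x y : A.Bam) : A.Bam :=
  (x.1 * y.1 + ζ * A.tb x.2.1 y.2.2.1,
   x.1 • y.2.1 + y.2.2.2 • x.2.1 + ζ • A.cross x.2.2.1 y.2.2.1,
   y.1 • x.2.2.1 + x.2.2.2 • y.2.2.1 + A.cross x.2.1 y.2.1,
   x.2.2.2 * y.2.2.2 + ζ * A.tb y.2.1 x.2.2.1)

/-- The involution `(α,j;j',β)‾ = (β,j;j',α)` of `B(J, F×F, ζ)`. -/
def binv (x : A.Bam) : A.Bam := (x.2.2.2, x.2.1, x.2.2.1, x.1)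

/-- The skew-symmetric element `s₀ = (1,0;0,−1)`. -/
def s0 : A.Bam := (1, 0, 0, -1)

/-- The triple product `{x,y,z} := (x·ȳ)·z + (z·ȳ)·x − (z·x̄)·y` in `B(J, F×F, ζ)`. -/
def brace (ζ : F) (x y z : A.Bam) : A.Bam :=
  A.bmul ζ (A.bmul ζ x (A.binv y)) z + A.bmul ζ (A.bmul ζ z (A.binv y)) x
    - A.bmul ζ (A.bmul ζ z (A.binv x)) y

/-- The bilinear form of the triple system associated to `B(J, F×F, ζ)` and a skew element
`s`: `b(x,y)` is the unique scalar with `b(x,y)•1 = (x·ȳ − y·x̄)·s`; since the unit of the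
algebra is `(1,0;0,1)`, it is the first component of the right-hand side. -/
def bformS (ζ : F) (s x y : A.Bam) : F :=
  (A.bmul ζ (A.bmul ζ x (A.binv y) - A.bmul ζ y (A.binv x)) s).1

/-- The trilinear product of the triple system associated to `B(J, F×F, ζ)` and `s`:
`t(y,z,w) := 2{y, s·z, w} − b(z,w)·y − b(z,y)·w − b(y,w)·z`. -/
def tformS (ζ : F) (s y z w : A.Bam) : A.Bam :=
  (2 : F) • A.brace ζ y (A.bmul ζ s z) w - A.bformS ζ s z w • y - A.bformS ζ s z y • w
    - A.bformS ζ s y w • z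

/-- The bilinear form of the triple system associated to `B(J, F×F, ζ)` and `s₀`. -/
def bform (ζ : F) (x y : A.Bam) : F := A.bformS ζ A.s0 x y

/-- The trilinear product of the triple system associated to `B(J, F×F, ζ)` and `s₀`. -/
def tform (ζ : F) (y z w : A.Bam) : A.Bam := A.tformS ζ A.s0 y z w

/-- `e` is a singular element of `B(J, F×F, ζ)`: `e ≠ 0` and `U_e(B) ⊆ F·e`
where `U_e(x) := {e,x,e}`. -/
def IsSingular (ζ : F) (e : A.Bam) : Prop :=
  e ≠ 0 ∧ ∀ x ∈ A.Bsub, ∃ c : F, A.brace ζ e x e = c • e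

/-- `I` is an inner ideal of `B(J, F×F, ζ)`: a subspace of `B` with `U_e(B) ⊆ I`
for all `e ∈ I`. -/
def IsInnerIdeal (ζ : F) (I : Submodule F A.Bam) : Prop :=
  I ≤ A.Bsub ∧ ∀ e ∈ I, ∀ x ∈ A.Bsub, A.brace ζ e x e ∈ I

end ReducedAlbert


namespace ReducedAlbert

variable {F : Type u} [Field F] (A : ReducedAlbert.{u, v} F)

/-- `Φ(S) = {j ∈ J : ⟨w,j⟩ = 0 in End_F(J) for all w ∈ S}`. -/
def dualSet (S : Set A.M) : Set A.M :=
  {j | j ∈ A.J ∧ ∀ w ∈ S, ∀ z ∈ A.J, A.brok w j z = 0}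

/-- `W` is a totally singular subspace of `J`. -/
def IsTS (W : Submodule F A.M) : Prop := W ≤ A.J ∧ ∀ w ∈ W, A.sharp w = 0

/-- `W` is a maximal totally singular subspace of `J`. -/
def IsMaxTS (W : Submodule F A.M) : Prop :=
  A.IsTS W ∧ ∀ W' : Submodule F A.M, A.IsTS W' → W ≤ W' → W' = W

/-- `H` is a hyperline of `J`: `H = d × J` for some rank-one `d`. -/
def IsHyperline (H : Submodule F A.M) : Prop :=
  ∃ d ∈ A.J, d ≠ 0 ∧ A.sharp d = 0 ∧
    (H : Set A.M) = {x : A.M | ∃ k ∈ A.J, x = A.cross d k}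

end ReducedAlbert

section LinearAlgebra

variable {F : Type*} {V : Type*} [Field F] [AddCommGroup V] [Module F V]

/-- A line in a subspace `U` has a complement in `U`. -/
lemma exists_sup_span_singleton [FiniteDimensional F V] {U : Submodule F V} {m : ℕ}
    (hU : Module.finrank F U = m + 1) {w : V} (hw : w ∈ U) (hw0 : w ≠ 0) :
    ∃ U' : Submodule F V, w ∉ U' ∧ U = U' ⊔ Submodule.span F {w} ∧ Module.finrank F U' = m := by
  obtain ⟨q, hq⟩ := Submodule.exists_isCompl (Submodule.span F {w})
  have hwq : w ∉ q ⊓ U := fun h => hw0 (by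
    have := Submodule.disjoint_def.1 hq.disjoint w (Submodule.mem_span_singleton_self w) h.1
    exact this)
  have hU' : U = (q ⊓ U) ⊔ Submodule.span F {w} := by
    rw [sup_comm, ← sup_inf_assoc_of_le q ((Submodule.span_singleton_le_iff_mem _ _).2 hw),
      hq.sup_eq_top, top_inf_eq]
  refine ⟨q ⊓ U, hwq, hU', ?_⟩
  have := Submodule.finrank_sup_span_singleton hwq
  rw [← hU', hU] at this
  omega

lemma exists_ne_zero_of_finrank_eq_succ {U : Submodule F V} {m : ℕ}
    (hU : Module.finrank F U = m + 1) : ∃ w ∈ U, w ≠ 0 := by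
  refine (Submodule.ne_bot_iff U).1 fun h => ?_
  rw [h, finrank_bot] at hU
  omega

/-- A skew-symmetric form on an odd-dimensional space is degenerate. -/
lemma exists_radical_of_skew [FiniteDimensional F V] (h2 : (2 : F) ≠ 0)
    (hodd : Odd (Module.finrank F V)) (β : LinearMap.BilinForm F V)
    (hβ : ∀ x y, β x y = -β y x) : ∃ x ≠ 0, ∀ y, β x y = 0 := by
  by_contra! hcon
  have hrefl : β.IsRefl := fun x y h => by rw [hβ, h, neg_zero]
  have hnd : β.Nondegenerate := by
    refine hrefl.nondegenerate_iff_separatingLeft.2 fun x hx => ?_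
    by_contra h0
    obtain ⟨y, hy⟩ := hcon x h0
    exact hy (hx y)
  let b := Module.finBasis F V
  have hdet := (LinearMap.BilinForm.nondegenerate_iff_det_ne_zero b).1 hnd
  have hskew : (LinearMap.BilinForm.toMatrix b β).transpose =
      -LinearMap.BilinForm.toMatrix b β := by
    ext i j
    simp only [Matrix.transpose_apply, Matrix.neg_apply, LinearMap.BilinForm.toMatrix_apply]
    exact hβ _ _
  have h := Matrix.det_transpose (LinearMap.BilinForm.toMatrix b β)
  rw [hskew, Matrix.det_neg, Fintype.card_fin, hodd.neg_one_pow] at h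
  apply hdet
  have : (2 : F) * (LinearMap.BilinForm.toMatrix b β).det = 0 := by linear_combination -h
  exact (mul_eq_zero.1 this).resolve_left h2

/-- Three totally isotropic subspaces of the same odd dimension `n` in a nondegenerate space of
dimension `2n` cannot be pairwise complementary. -/
lemma false_of_three_isotropic [FiniteDimensional F V] (h2 : (2 : F) ≠ 0)
    (B : V →ₗ[F] V →ₗ[F] F) (hB : ∀ x y, B x y = B y x) {n : ℕ} (hn : Odd n)
    {N₁ N₂ N₃ : Submodule F V} (h1 : ∀ x ∈ N₁, ∀ y ∈ N₁, B x y = 0)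
    (h2' : ∀ x ∈ N₂, ∀ y ∈ N₂, B x y = 0) (h3 : ∀ x ∈ N₃, ∀ y ∈ N₃, B x y = 0)
    (hd₂ : Module.finrank F N₂ = n) (hd₃ : Module.finrank F N₃ = n)
    (h12 : N₁ ⊓ N₂ = ⊥) (h13 : N₁ ⊓ N₃ = ⊥) (h23 : N₂ ⊓ N₃ = ⊥)
    (hle : N₃ ≤ N₁ ⊔ N₂) (hnd : ∀ x ∈ N₁, (∀ y ∈ N₂, B x y = 0) → x = 0) : False := by
  obtain ⟨q, hq, hqc⟩ : ∃ q : Submodule F V, N₁ ≤ q ∧ IsCompl q N₂ := by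
    obtain ⟨q, hq, hqc⟩ := (disjoint_iff.2 h12).exists_isCompl
    exact ⟨q, hq, hqc⟩
  let a : V →ₗ[F] V := q.subtype ∘ₗ q.projectionOnto N₂ hqc
  have hab : ∀ x ∈ N₃, a x ∈ N₁ ∧ x - a x ∈ N₂ := by
    intro x hx
    obtain ⟨y, hy, z, hz, rfl⟩ := Submodule.mem_sup.1 (hle hx)
    have : a (y + z) = y := by
      have e1 := Submodule.projectionOnto_apply_left hqc ⟨y, hq hy⟩
      have e2 := Submodule.projectionOnto_apply_right hqc ⟨z, hz⟩
      simp only [a, LinearMap.comp_apply, map_add, Submodule.subtype_apply] at *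
      rw [e1, e2]; simp
    rw [this]
    exact ⟨hy, by simpa using hz⟩
  let b : N₃ →ₗ[F] N₂ := LinearMap.codRestrict N₂ ((LinearMap.id - a) ∘ₗ N₃.subtype)
    (fun x => (hab x x.2).2)
  have hbinj : Function.Injective b := by
    rw [← LinearMap.ker_eq_bot, LinearMap.ker_eq_bot']
    intro x hx
    have hx' : (x : V) - a x = 0 := congrArg Subtype.val hx
    have : (x : V) ∈ N₁ ⊓ N₃ := ⟨by rw [sub_eq_zero.1 hx']; exact (hab x x.2).1, x.2⟩
    rw [h13] at this
    exact Subtype.ext this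
  have hbsurj : Function.Surjective b :=
    (LinearMap.injective_iff_surjective_of_finrank_eq_finrank (hd₃.trans hd₂.symm)).1 hbinj
  let β : LinearMap.BilinForm F N₃ := B.compl₁₂ (a ∘ₗ N₃.subtype) (N₂.subtype ∘ₗ b)
  have hβ : ∀ x y, β x y = B (a x) (y - a y) := fun x y => rfl
  obtain ⟨x, hx0, hx⟩ := exists_radical_of_skew h2 (by rwa [hd₃]) β (by
    intro x y
    rw [hβ, hβ]
    have e1 := h1 _ (hab x x.2).1 _ (hab y y.2).1
    have e2 := h2' _ (hab x x.2).2 _ (hab y y.2).2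
    have e3 := h3 _ x.2 _ y.2
    have e4 := hB (a y) x
    have e5 := hB (a y) (a x)
    simp only [map_sub, LinearMap.sub_apply] at *
    linear_combination e3 - e2 + e4 - e5 - e1)
  apply hx0
  have hax : a x = 0 := by
    refine hnd _ (hab x x.2).1 fun y hy => ?_
    obtain ⟨u, hu⟩ := hbsurj ⟨y, hy⟩
    have := hx u
    rw [hβ] at this
    rw [← this]
    exact congrArg (B (a x)) (congrArg Subtype.val hu).symm
  have : (x : V) ∈ N₂ ⊓ N₃ := ⟨by have := (hab x x.2).2; rwa [hax, sub_zero] at this, x.2⟩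
  rw [h23] at this
  exact Subtype.ext this

/-- A functional vanishing on `U` with value `1` at `w ∉ U`, represented by a nondegenerate form. -/
lemma exists_form_eq_one [FiniteDimensional F V] (T : V →ₗ[F] V →ₗ[F] F)
    (hT : ∀ x, (∀ y, T x y = 0) → x = 0) {U : Submodule F V} {w : V} (hw : w ∉ U) :
    ∃ k, T k w = 1 ∧ ∀ u ∈ U, T k u = 0 := by
  obtain ⟨f, hf, hfU⟩ := Submodule.exists_dual_map_eq_bot_of_notMem hw inferInstance
  have hinj : Function.Injective T := by
    rw [← LinearMap.ker_eq_bot, LinearMap.ker_eq_bot']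
    exact fun x hx => hT x fun y => by rw [hx]; rfl
  have hsurj := (LinearMap.injective_iff_surjective_of_finrank_eq_finrank
    (Subspace.dual_finrank_eq (K := F) (V := V)).symm).1 hinj
  obtain ⟨k, hk⟩ := hsurj f
  refine ⟨(f w)⁻¹ • k, ?_, fun u hu => ?_⟩
  · rw [map_smul, hk, LinearMap.smul_apply, smul_eq_mul, inv_mul_cancel₀ hf]
  · have : f u ∈ U.map f := Submodule.mem_map_of_mem hu
    rw [hfU, Submodule.mem_bot] at this
    rw [map_smul, hk, LinearMap.smul_apply, this, smul_zero]

end LinearAlgebra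

/-- A 27-dimensional space with a cubic form, given by its Freudenthal cross product and trace
form, satisfying the polarized adjoint identity `x^# ^# = N(x) x`, in which rank one elements are
plentiful and define hyperlines of dimension 10. -/
structure CubicSpace (F : Type*) (V : Type*) [Field F] [AddCommGroup V] [Module F V] where
  cr : V →ₗ[F] V →ₗ[F] V
  T : V →ₗ[F] V →ₗ[F] F
  two_ne : (2 : F) ≠ 0
  three_ne : (3 : F) ≠ 0
  cr_comm : ∀ x y, cr x y = cr y x
  T_comm : ∀ x y, T x y = T y x
  T_nondeg : ∀ x, (∀ y, T x y = 0) → x = 0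
  T_cr : ∀ x y z, T (cr x y) z = T x (cr y z)
  quartic : ∀ x y u v, cr (cr x y) (cr u v) + cr (cr x u) (cr y v) + cr (cr x v) (cr y u)
    = T (cr x y) u • v + T (cr x y) v • u + T (cr x u) v • y + T (cr y u) v • x
  finrank_eq : Module.finrank F V = 27
  exists_rankOne_pair : ∀ x ≠ 0, ∃ d e, cr d d = 0 ∧ T x d ≠ 0 ∧ cr e e = 0 ∧ T d e ≠ 0 ∧
    Module.finrank F (LinearMap.range (cr e)) = 10

namespace CubicSpace

variable {F : Type*} {V : Type*} [Field F] [AddCommGroup V] [Module F V] (P : CubicSpace F V)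

lemma finiteDimensional (P : CubicSpace F V) : FiniteDimensional F V :=
  Module.finite_of_finrank_pos (by rw [P.finrank_eq]; norm_num)

lemma ext_T {x y : V} (h : ∀ w, P.T x w = P.T y w) : x = y :=
  sub_eq_zero.1 (P.T_nondeg _ fun w => by rw [map_sub, LinearMap.sub_apply, h, sub_self])

lemma T_cr_swap (x y z : V) : P.T (P.cr x y) z = P.T (P.cr x z) y := by
  rw [P.cr_comm x y, P.T_cr, P.T_comm]

lemma T_adj (x y z w : V) : P.T (P.cr x (P.cr y w)) z = P.T (P.cr y (P.cr x z)) w := by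
  rw [P.T_cr_swap, P.T_comm, P.T_cr_swap]

lemma T_cr_left {d : V} (hd : P.cr d d = 0) (x : V) : P.T (P.cr d x) d = 0 := by
  rw [P.T_cr_swap, hd, map_zero, LinearMap.zero_apply]

/-- The hyperline `d × V`. -/
def hyper (d : V) : Submodule F V := LinearMap.range (P.cr d)

lemma cr_mem_hyper (d k : V) : P.cr d k ∈ P.hyper d := ⟨k, rfl⟩

lemma T_hyper {d y : V} (hd : P.cr d d = 0) (hy : y ∈ P.hyper d) : P.T y d = 0 := by
  obtain ⟨k, rfl⟩ := hy
  exact P.T_cr_left hd k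

lemma cr_cr_cr {d : V} (hd : P.cr d d = 0) (x y : V) :
    P.cr (P.cr d x) (P.cr d y) = P.T (P.cr d x) y • d := by
  have h := P.quartic d x d y
  rw [hd, map_zero, LinearMap.zero_apply, map_zero, LinearMap.zero_apply, P.T_cr_left hd,
    P.cr_comm x d, P.cr_comm (P.cr d y), zero_smul, zero_smul] at h
  have h' : (2 : F) • (P.cr (P.cr d x) (P.cr d y) - P.T (P.cr d x) y • d) = 0 := by
    linear_combination (norm := module) h
  exact sub_eq_zero.1 ((smul_eq_zero.1 h').resolve_left P.two_ne)

lemma hyper_cr_cr {d y : V} (hd : P.cr d d = 0) (hy : y ∈ P.hyper d) (k : V) :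
    P.cr y (P.cr d k) = P.T y k • d := by
  obtain ⟨m, rfl⟩ := hy
  exact P.cr_cr_cr hd m k

lemma cr_hyper_cr {d y : V} (hd : P.cr d d = 0) (hy : y ∈ P.hyper d) (k : V) :
    P.cr d (P.cr y k) = P.T k d • y := by
  refine P.ext_T fun w => ?_
  rw [P.T_adj, P.hyper_cr_cr hd hy]
  simp [mul_comm, P.T_comm d]

lemma exists_rankOne (x : V) (hx : x ≠ 0) : ∃ d, P.cr d d = 0 ∧ P.T x d ≠ 0 := by
  obtain ⟨d, -, hd, hxd, -⟩ := P.exists_rankOne_pair x hx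
  exact ⟨d, hd, hxd⟩

lemma finrank_hyper_le {d z : V} (hd : P.cr d d = 0) (hdz : P.T d z ≠ 0) :
    Module.finrank F (P.hyper d) ≤ Module.finrank F (P.hyper z) := by
  have := P.finiteDimensional
  have hle : P.hyper d ≤ (P.hyper z).map (P.cr d) := by
    intro y hy
    refine ⟨(P.T d z)⁻¹ • P.cr z y, Submodule.smul_mem _ _ (P.cr_mem_hyper z y), ?_⟩
    rw [map_smul, P.cr_comm z, P.cr_hyper_cr hd hy, P.T_comm z, smul_smul, inv_mul_cancel₀ hdz,
      one_smul]
  exact (Submodule.finrank_mono hle).trans (Submodule.finrank_map_le _ _)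

lemma finrank_hyper_eq {d z : V} (hd : P.cr d d = 0) (hz : P.cr z z = 0) (hdz : P.T d z ≠ 0) :
    Module.finrank F (P.hyper d) = Module.finrank F (P.hyper z) :=
  le_antisymm (P.finrank_hyper_le hd hdz) (P.finrank_hyper_le hz (by rwa [P.T_comm]))

lemma finrank_range (d : V) (hd0 : d ≠ 0) (hd : P.cr d d = 0) :
    Module.finrank F (LinearMap.range (P.cr d)) = 10 := by
  obtain ⟨z, e, hz, hdz, he, hze, h10⟩ := P.exists_rankOne_pair d hd0
  exact (P.finrank_hyper_eq hd hz hdz).trans ((P.finrank_hyper_eq hz he hze).trans h10)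

/-- Incidence of a point `x` and a point `y` of the dual space: the operator `⟨x,y⟩` vanishes. -/
def Inc (x y : V) : Prop :=
  ∀ z, P.cr y (P.cr x z) = P.T z y • x + ((3 : F)⁻¹ * P.T x y) • z

variable {P}

lemma Inc.symm {x y : V} (h : P.Inc x y) : P.Inc y x := by
  intro w
  refine P.ext_T fun z => ?_
  have := congrArg (fun u => P.T u w) (h z)
  simp only [map_add, map_smul, LinearMap.add_apply, LinearMap.smul_apply, smul_eq_mul] at this ⊢
  rw [P.T_adj, this, P.T_comm w x, P.T_comm y z, P.T_comm w z, P.T_comm y x]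
  ring

end CubicSpace

namespace CubicSpace

variable {F : Type*} {V : Type*} [Field F] [AddCommGroup V] [Module F V] {P : CubicSpace F V}

lemma Inc.T_eq_zero {d y : V} (hd : P.cr d d = 0) (hd0 : d ≠ 0) (h : P.Inc d y) :
    P.T d y = 0 := by
  have h1 := h d
  rw [hd, map_zero, ← add_smul, eq_comm, smul_eq_zero] at h1
  have h2 := h1.resolve_right hd0
  have h3 := P.three_ne
  field_simp at h2
  have h4 : (2 : F) * 2 * P.T d y = 0 := by linear_combination h2
  simpa [P.two_ne] using h4

variable (P) in
lemma exists_T_eq_one {x : V} (hx : x ≠ 0) : ∃ k, P.T k x = 1 := by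
  obtain ⟨k, hk⟩ : ∃ k, P.T x k ≠ 0 := by
    by_contra! h
    exact hx (P.T_nondeg x h)
  refine ⟨(P.T x k)⁻¹ • k, ?_⟩
  rw [map_smul, LinearMap.smul_apply, P.T_comm k, smul_eq_mul, inv_mul_cancel₀ hk]

lemma inc_iff_mem_hyper {d y : V} (hd : P.cr d d = 0) (hd0 : d ≠ 0) :
    P.Inc d y ↔ y ∈ P.hyper d := by
  constructor
  · intro h
    obtain ⟨k, hk⟩ := P.exists_T_eq_one hd0
    have h1 := h.symm k
    rw [P.T_comm y d, h.T_eq_zero hd hd0, mul_zero, zero_smul, add_zero, hk, one_smul] at h1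
    rw [← h1]
    exact P.cr_mem_hyper _ _
  · intro h k
    rw [P.hyper_cr_cr hd h, P.T_comm d y, P.T_hyper hd h, mul_zero, zero_smul, add_zero, P.T_comm]

lemma Inc.add {w x y : V} (hx : P.Inc w x) (hy : P.Inc w y) : P.Inc w (x + y) := fun z => by
  have h1 := hx z
  have h2 := hy z
  simp only [map_add, LinearMap.add_apply]
  rw [h1, h2]
  module

lemma Inc.smul {w x : V} (c : F) (hx : P.Inc w x) : P.Inc w (c • x) := fun z => by
  have h1 := hx z
  simp only [map_smul, LinearMap.smul_apply, smul_eq_mul]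
  rw [h1]
  module

lemma inc_zero (w : V) : P.Inc w 0 := fun z => by simp

variable (P) in
/-- The subspace of all points incident with every point of `S`. -/
def dual (S : Set V) : Submodule F V where
  carrier := {y | ∀ w ∈ S, P.Inc w y}
  add_mem' ha hb w hw := (ha w hw).add (hb w hw)
  zero_mem' w _ := inc_zero w
  smul_mem' c _ ha w hw := (ha w hw).smul c

variable (P) in
/-- Totally singular subspaces. -/
def TS (W : Submodule F V) : Prop := ∀ w ∈ W, P.cr w w = 0

lemma TS.cr_eq_zero {W : Submodule F V} (h : P.TS W) {x y : V} (hx : x ∈ W) (hy : y ∈ W) :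
    P.cr x y = 0 := by
  have h1 := h _ (W.add_mem hx hy)
  simp only [map_add, LinearMap.add_apply] at h1
  rw [h x hx, h y hy, P.cr_comm y x] at h1
  have h2 : (2 : F) • P.cr x y = 0 := by linear_combination (norm := module) h1
  exact (smul_eq_zero.1 h2).resolve_left P.two_ne

lemma TS.mono {W W' : Submodule F V} (h : P.TS W) (hle : W' ≤ W) : P.TS W' :=
  fun w hw => h w (hle hw)

lemma TS.sup_span {W : Submodule F V} (h : P.TS W) {s : V} (hs : P.cr s s = 0)
    (hsW : ∀ w ∈ W, P.cr w s = 0) : P.TS (W ⊔ Submodule.span F {s}) := by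
  intro x hx
  obtain ⟨w, hw, y, hy, rfl⟩ := Submodule.mem_sup.1 hx
  obtain ⟨c, rfl⟩ := Submodule.mem_span_singleton.1 hy
  simp [h w hw, hs, hsW w hw, P.cr_comm s w]

lemma dual_anti {S S' : Set V} (h : S ⊆ S') : P.dual S' ≤ P.dual S :=
  fun _ hy w hw => hy w (h hw)

lemma le_dual_dual (S : Set V) : S ⊆ P.dual (P.dual S) :=
  fun _ hw _ hy => (hy _ hw).symm

lemma mem_hyper_of_mem_dual {S : Set V} {d y : V} (hy : y ∈ P.dual S) (hd : d ∈ S)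
    (hd1 : P.cr d d = 0) (hd0 : d ≠ 0) : y ∈ P.hyper d :=
  (inc_iff_mem_hyper hd1 hd0).1 (hy d hd)

lemma le_hyper_of_mem_dual {W : Submodule F V} {z : V} (hz : z ∈ P.dual W)
    (hz1 : P.cr z z = 0) (hz0 : z ≠ 0) : W ≤ P.hyper z :=
  fun _ hw => (inc_iff_mem_hyper hz1 hz0).1 (hz _ hw).symm

lemma mem_dual_of_le_hyper {W : Submodule F V} {z : V} (h : W ≤ P.hyper z)
    (hz1 : P.cr z z = 0) (hz0 : z ≠ 0) : z ∈ P.dual W :=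
  fun _ hw => ((inc_iff_mem_hyper hz1 hz0).2 (h hw)).symm

lemma dual_span_singleton {d : V} (hd : P.cr d d = 0) (hd0 : d ≠ 0) :
    P.dual (Submodule.span F {d} : Submodule F V) = P.hyper d := by
  ext y
  constructor
  · intro hy
    exact mem_hyper_of_mem_dual hy (Submodule.mem_span_singleton_self d) hd hd0
  · intro hy w hw
    obtain ⟨c, rfl⟩ := Submodule.mem_span_singleton.1 hw
    exact (((inc_iff_mem_hyper hd hd0).2 hy).symm.smul c).symm

lemma dual_hyper {d : V} (hd : P.cr d d = 0) (hd0 : d ≠ 0) :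
    P.dual (P.hyper d) = Submodule.span F {d} := by
  apply le_antisymm
  · intro x hx
    have hT : ∀ k, P.T (P.cr d k) x = 0 := fun k => by
      have h1 := (hx _ (P.cr_mem_hyper d k)).symm d
      rw [P.cr_comm x d, P.cr_cr_cr hd, P.T_comm d, P.T_cr_left hd, zero_smul, zero_add,
        P.T_comm x] at h1
      have h2 : (P.T (P.cr d k) x - (3 : F)⁻¹ * P.T (P.cr d k) x) • d = 0 := by
        rw [sub_smul, h1, sub_self]
      have h3 := (smul_eq_zero.1 h2).resolve_right hd0
      have := P.three_ne
      field_simp at h3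
      have h4 : (2 : F) * P.T (P.cr d k) x = 0 := by linear_combination h3
      simpa [P.two_ne] using h4
    have hdx : P.cr d x = 0 := P.T_nondeg _ fun k => by rw [P.T_cr_swap, hT]
    have hinc : ∀ k z, P.cr (P.cr d k) (P.cr x z) = P.T z (P.cr d k) • x := fun k z => by
      rw [(hx _ (P.cr_mem_hyper d k)).symm z, P.T_comm x, hT, mul_zero, zero_smul, add_zero]
    have key : ∀ k z, P.T (P.cr d k) z • x = P.T (P.cr k x) z • d := fun k z => by
      have h := P.quartic d k x z
      rw [hdx, hT, hinc, P.cr_comm k x, hinc, P.T_comm k, P.T_cr_swap d z, P.T_comm z,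
        P.cr_comm x k] at h
      simp only [map_zero, LinearMap.zero_apply, zero_smul] at h
      linear_combination (norm := module) h
    obtain ⟨k, hk⟩ : ∃ k, P.cr d k ≠ 0 := by
      by_contra! h
      have h1 := P.finrank_range d hd0 hd
      rw [LinearMap.range_eq_bot.2 (LinearMap.ext h), finrank_bot] at h1
      omega
    obtain ⟨z, hz⟩ := P.exists_T_eq_one hk
    rw [P.T_comm] at hz
    refine Submodule.mem_span_singleton.2 ⟨P.T (P.cr k x) z, ?_⟩
    rw [← key, hz, one_smul]
  · rw [Submodule.span_singleton_le_iff_mem]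
    exact fun w hw => ((inc_iff_mem_hyper hd hd0).2 hw).symm

end CubicSpace

namespace CubicSpace

variable {F : Type*} {V : Type*} [Field F] [AddCommGroup V] [Module F V]

/-- A pair of rank one elements, one in the space and one in its dual, with pairing `1`. -/
structure Frame (P : CubicSpace F V) (d z : V) : Prop where
  left : P.cr d d = 0
  right : P.cr z z = 0
  one : P.T d z = 1

/-- The half space of a frame. -/
def half (P : CubicSpace F V) (d z : V) : Submodule F V :=
  LinearMap.ker (P.T z) ⊓ LinearMap.ker (P.cr z ∘ₗ P.cr d)

/-- The elements of the half space of a frame killed by `U`. -/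
def kerL (P : CubicSpace F V) (d z : V) (U : Submodule F V) : Submodule F V where
  carrier := {s | s ∈ P.half d z ∧ ∀ u ∈ U, P.cr u s = 0}
  add_mem' ha hb := ⟨add_mem ha.1 hb.1, fun u hu => by rw [map_add, ha.2 u hu, hb.2 u hu, add_zero]⟩
  zero_mem' := ⟨zero_mem _, fun _ _ => map_zero _⟩
  smul_mem' c _ ha := ⟨Submodule.smul_mem _ c ha.1, fun u hu => by
    rw [map_smul, ha.2 u hu, smul_zero]⟩

variable {P : CubicSpace F V} {d z : V}

lemma mem_half {s : V} : s ∈ P.half d z ↔ P.T z s = 0 ∧ P.cr z (P.cr d s) = 0 := by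
  simp [half, Submodule.mem_inf]

lemma mem_kerL {U : Submodule F V} {s : V} :
    s ∈ P.kerL d z U ↔ s ∈ P.half d z ∧ ∀ u ∈ U, P.cr u s = 0 := Iff.rfl

lemma kerL_bot : P.kerL d z ⊥ = P.half d z := by
  ext s
  simp [mem_kerL]

lemma kerL_anti {U U' : Submodule F V} (h : U ≤ U') : P.kerL d z U' ≤ P.kerL d z U :=
  fun _ hs => ⟨hs.1, fun u hu => hs.2 u (h hu)⟩

lemma exists_frame (hz : P.cr z z = 0) (hz0 : z ≠ 0) : ∃ d, P.Frame d z := by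
  obtain ⟨d, hd, h⟩ := P.exists_rankOne z hz0
  refine ⟨(P.T z d)⁻¹ • d, ?_, hz, ?_⟩
  · simp [hd]
  · rw [map_smul, LinearMap.smul_apply, P.T_comm d, smul_eq_mul, inv_mul_cancel₀ h]

namespace Frame


lemma symm (fr : P.Frame d z) : P.Frame z d := ⟨fr.right, fr.left, by rw [P.T_comm, fr.one]⟩

lemma ne_zero (fr : P.Frame d z) : z ≠ 0 := fun h => by
  have := fr.one
  rw [h, map_zero] at this
  exact zero_ne_one this

lemma cr_cr (fr : P.Frame d z) {w : V} (hw : w ∈ P.hyper z) : P.cr z (P.cr d w) = w := by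
  rw [P.cr_comm d, P.cr_hyper_cr fr.right hw, fr.one, one_smul]

lemma cr_half (fr : P.Frame d z) {s : V} (hs : s ∈ P.half d z) : P.cr d s = 0 := by
  rw [← fr.symm.cr_cr (P.cr_mem_hyper d s), (mem_half.1 hs).2, map_zero]

lemma T_cr_half (fr : P.Frame d z) {s : V} (hs : s ∈ P.half d z) (x : V) :
    P.T (P.cr d x) s = 0 := by
  rw [P.T_cr_swap, fr.cr_half hs, map_zero, LinearMap.zero_apply]

lemma half_component (fr : P.Frame d z) (x : V) :
    x - P.T x z • d - P.cr z (P.cr d x) ∈ P.half d z := by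
  rw [mem_half]
  constructor
  · rw [map_sub, map_sub, map_smul, fr.symm.one, P.T_comm x, P.T_comm z (P.cr _ _),
      P.T_cr_left fr.right]
    simp
  · simp [fr.left, fr.symm.cr_cr (P.cr_mem_hyper d x)]

lemma cr_mem_half (fr : P.Frame d z) {w s : V} (hw : w ∈ P.hyper z) (hs : s ∈ P.half d z) :
    P.cr w s ∈ P.half z d := by
  rw [mem_half]
  constructor
  · rw [P.T_comm, P.cr_comm, P.T_cr_swap, P.cr_comm s, fr.cr_half hs, map_zero,
      LinearMap.zero_apply]
  · rw [P.cr_hyper_cr fr.right hw, P.T_comm, (mem_half.1 hs).1, zero_smul, map_zero]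

lemma clifford (fr : P.Frame d z) {w w' s : V} (hw : w ∈ P.hyper z) (hw' : w' ∈ P.hyper z)
    (hs : s ∈ P.half d z) :
    P.cr (P.cr d w) (P.cr w' s) + P.cr (P.cr d w') (P.cr w s) = P.T (P.cr d w) w' • s := by
  have h := P.quartic d w w' s
  have h1 : P.T (P.cr w w') s = 0 := by
    obtain ⟨k, rfl⟩ := hw'
    rw [P.hyper_cr_cr fr.right hw, map_smul, LinearMap.smul_apply, (mem_half.1 hs).1, smul_zero]
  rw [fr.cr_half hs, fr.T_cr_half hs, fr.T_cr_half hs, h1] at h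
  simpa using h

lemma clifford_self (fr : P.Frame d z) {w s : V} (hw : w ∈ P.hyper z) (hs : s ∈ P.half d z) :
    (2 : F) • P.cr (P.cr d w) (P.cr w s) = P.T (P.cr d w) w • s := by
  rw [← fr.clifford hw hw hs, two_smul]

lemma clifford_dual (fr : P.Frame d z) {w w' t : V} (hw : w ∈ P.hyper z) (hw' : w' ∈ P.hyper z)
    (ht : t ∈ P.half z d) :
    P.cr w (P.cr (P.cr d w') t) + P.cr w' (P.cr (P.cr d w) t) = P.T (P.cr d w) w' • t := by
  have h := fr.symm.clifford (P.cr_mem_hyper d w) (P.cr_mem_hyper d w') ht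
  rw [fr.cr_cr hw, fr.cr_cr hw', P.T_comm, P.T_cr_swap] at h
  rw [h, P.T_cr_swap]

lemma T_map (fr : P.Frame d z) {w w' : V} (hw : w ∈ P.hyper z) :
    P.T (P.cr z (P.cr d w)) (P.cr d w') = P.T (P.cr d w) w' := by
  rw [fr.cr_cr hw, P.T_comm, P.T_cr_swap]

lemma map_map (fr : P.Frame d z) {U : Submodule F V} (hU : U ≤ P.hyper z) :
    (U.map (P.cr d)).map (P.cr z) = U := by
  ext x
  simp only [Submodule.mem_map]
  constructor
  · rintro ⟨y, ⟨u, hu, rfl⟩, rfl⟩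
    rwa [fr.cr_cr (hU hu)]
  · intro hx
    exact ⟨_, ⟨x, hx, rfl⟩, fr.cr_cr (hU hx)⟩

lemma map_le_hyper (U : Submodule F V) : U.map (P.cr d) ≤ P.hyper d := by
  rintro _ ⟨u, -, rfl⟩
  exact P.cr_mem_hyper d u

end Frame

end CubicSpace

/-- Rank-nullity for the restriction of a linear map to a subspace. -/
lemma finrank_eq_inf_ker_add_map {F V V' : Type*} [Field F] [AddCommGroup V] [Module F V]
    [AddCommGroup V'] [Module F V'] [FiniteDimensional F V] (L : V →ₗ[F] V')
    (K : Submodule F V) :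
    Module.finrank F K
      = Module.finrank F (K ⊓ LinearMap.ker L : Submodule F V) + Module.finrank F (K.map L) := by
  have h := (L.domRestrict K).finrank_range_add_finrank_ker
  rw [LinearMap.range_domRestrict, LinearMap.ker_domRestrict,
    ← Submodule.finrank_map_subtype_eq, Submodule.map_comap_subtype] at h
  omega

namespace CubicSpace

variable {F : Type*} {V : Type*} [Field F] [AddCommGroup V] [Module F V]
  {P : CubicSpace F V} {d z : V}

namespace Frame


lemma finrank_half (fr : P.Frame d z) : Module.finrank F (P.half d z) = 16 := by
  have := P.finiteDimensional
  let φ : V →ₗ[F] V := (P.T z).smulRight d + P.cr z ∘ₗ P.cr d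
  have hφ : ∀ x, φ x = P.T z x • d + P.cr z (P.cr d x) := fun x => rfl
  have hker : LinearMap.ker φ = P.half d z := by
    ext x
    rw [LinearMap.mem_ker, mem_half, hφ]
    constructor
    · intro h
      have h1 : P.T z x = 0 := by
        have := congrArg (P.T z) h
        rw [map_add, map_smul, fr.symm.one, P.T_comm z (P.cr _ _), P.T_cr_left fr.right] at this
        simpa using this
      rw [h1, zero_smul, zero_add] at h
      exact ⟨h1, h⟩
    · rintro ⟨h1, h2⟩
      rw [h1, h2]; simp
  have hd : d ∉ P.hyper z := fun h => by
    have h1 := P.T_hyper fr.right h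
    rw [fr.one] at h1
    exact one_ne_zero h1
  have hrange : LinearMap.range φ = P.hyper z ⊔ Submodule.span F {d} := by
    apply le_antisymm
    · rintro _ ⟨x, rfl⟩
      rw [hφ, add_comm]
      exact Submodule.add_mem_sup (P.cr_mem_hyper _ _)
        (Submodule.smul_mem _ _ (Submodule.mem_span_singleton_self d))
    · refine sup_le (fun w hw => ⟨w, ?_⟩) ?_
      · rw [hφ, fr.cr_cr hw, P.T_comm, P.T_hyper fr.right hw, zero_smul, zero_add]
      · rw [Submodule.span_singleton_le_iff_mem]
        exact ⟨d, by rw [hφ, fr.left, fr.symm.one]; simp⟩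
  have h := φ.finrank_range_add_finrank_ker
  rw [hker, hrange, Submodule.finrank_sup_span_singleton hd, P.finrank_eq, hyper,
    P.finrank_range z fr.ne_zero fr.right] at h
  omega

lemma cr_mem_kerL (fr : P.Frame d z) {U : Submodule F V} (hU : U ≤ P.hyper z) {v s : V}
    (hv : v ∈ P.hyper z)
    (hvU : ∀ u ∈ U, P.T (P.cr d u) v = 0) (hs : s ∈ P.kerL d z U) :
    P.cr v s ∈ P.kerL z d (U.map (P.cr d)) := by
  refine ⟨fr.cr_mem_half hv hs.1, ?_⟩
  rintro _ ⟨u, hu, rfl⟩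
  have h := fr.clifford (hU hu) hv hs.1
  rw [hs.2 u hu, hvU u hu, zero_smul, map_zero, add_zero] at h
  exact h

/-- Adding an isotropic vector `w` to `U` splits the kernel of `U`. -/
lemma finrank_kerL_sup (fr : P.Frame d z) {U : Submodule F V} (hU : U ≤ P.hyper z) {w f : V}
    (hw : w ∈ P.hyper z) (hf : f ∈ P.hyper z) (hww : P.T (P.cr d w) w = 0)
    (hwU : ∀ u ∈ U, P.T (P.cr d u) w = 0) (hfU : ∀ u ∈ U, P.T (P.cr d u) f = 0)
    (hfw : P.T (P.cr d w) f = 1) :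
    Module.finrank F (P.kerL d z U) = Module.finrank F (P.kerL d z (U ⊔ Submodule.span F {w}))
      + Module.finrank F (P.kerL z d ((U ⊔ Submodule.span F {w}).map (P.cr d))) := by
  have := P.finiteDimensional
  have hw_mem : w ∈ U ⊔ Submodule.span F {w} :=
    Submodule.mem_sup_right (Submodule.mem_span_singleton_self w)
  have h_ker : P.kerL d z U ⊓ LinearMap.ker (P.cr w)
      = P.kerL d z (U ⊔ Submodule.span F {w}) := by
    apply le_antisymm
    · rintro s ⟨hs, hws⟩
      refine ⟨hs.1, fun x hx => ?_⟩
      obtain ⟨u, hu, y, hy, rfl⟩ := Submodule.mem_sup.1 hx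
      obtain ⟨c, rfl⟩ := Submodule.mem_span_singleton.1 hy
      rw [map_add, map_smul, LinearMap.add_apply, LinearMap.smul_apply, hs.2 u hu,
        LinearMap.mem_ker.1 hws, smul_zero, add_zero]
    · exact fun s hs => ⟨kerL_anti le_sup_left hs, hs.2 w hw_mem⟩
  have h_map : (P.kerL d z U).map (P.cr w)
      = P.kerL z d ((U ⊔ Submodule.span F {w}).map (P.cr d)) := by
    apply le_antisymm
    · rintro _ ⟨s, hs, rfl⟩
      refine ⟨fr.cr_mem_half hw hs.1, ?_⟩
      rintro _ ⟨x, hx, rfl⟩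
      obtain ⟨u, hu, y, hy, rfl⟩ := Submodule.mem_sup.1 hx
      obtain ⟨c, rfl⟩ := Submodule.mem_span_singleton.1 hy
      have h1 := (fr.cr_mem_kerL hU hw hwU hs).2 _ (Submodule.mem_map_of_mem hu)
      have h2 := fr.clifford_self hw hs.1
      rw [hww, zero_smul, smul_eq_zero] at h2
      simp [h1, h2.resolve_left P.two_ne]
    · rintro t ⟨ht, h⟩
      have hwt : P.cr (P.cr d w) t = 0 := h _ ⟨w, hw_mem, rfl⟩
      refine ⟨P.cr (P.cr d f) t, ⟨fr.symm.cr_mem_half (P.cr_mem_hyper _ _) ht, fun u hu => ?_⟩, ?_⟩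
      · have h1 := fr.clifford_dual (hU hu) hf ht
        rw [h _ ⟨u, Submodule.mem_sup_left hu, rfl⟩, hfU u hu] at h1
        simpa using h1
      · have h1 := fr.clifford_dual hw hf ht
        rw [hwt, hfw] at h1
        simpa using h1
  rw [finrank_eq_inf_ker_add_map (P.cr w) (P.kerL d z U), h_ker, h_map]

/-- Multiplication by an anisotropic vector orthogonal to `U` embeds one kernel in the other. -/
lemma finrank_kerL_le (fr : P.Frame d z) {U : Submodule F V} (hU : U ≤ P.hyper z) {v : V}
    (hv : v ∈ P.hyper z)
    (hvU : ∀ u ∈ U, P.T (P.cr d u) v = 0) (hvv : P.T (P.cr d v) v ≠ 0) :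
    Module.finrank F (P.kerL d z U) ≤ Module.finrank F (P.kerL z d (U.map (P.cr d))) := by
  have := P.finiteDimensional
  rw [finrank_eq_inf_ker_add_map (P.cr v) (P.kerL d z U)]
  have h0 : P.kerL d z U ⊓ LinearMap.ker (P.cr v) = ⊥ := by
    rw [Submodule.eq_bot_iff]
    rintro s ⟨hs, hvs⟩
    have h := fr.clifford_self hv hs.1
    rw [LinearMap.mem_ker.1 hvs, map_zero, smul_zero] at h
    exact (smul_eq_zero.1 h.symm).resolve_left hvv
  rw [h0, finrank_bot, zero_add]
  apply Submodule.finrank_mono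
  rintro _ ⟨s, hs, rfl⟩
  exact fr.cr_mem_kerL hU hv hvU hs

lemma finrank_kerL_eq (fr : P.Frame d z) {U : Submodule F V} (hU : U ≤ P.hyper z) {v : V}
    (hv : v ∈ P.hyper z)
    (hvU : ∀ u ∈ U, P.T (P.cr d u) v = 0) (hvv : P.T (P.cr d v) v ≠ 0) :
    Module.finrank F (P.kerL d z U) = Module.finrank F (P.kerL z d (U.map (P.cr d))) := by
  apply le_antisymm (fr.finrank_kerL_le hU hv hvU hvv)
  have h := fr.symm.finrank_kerL_le (U := U.map (P.cr d)) (map_le_hyper U)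
    (P.cr_mem_hyper d v) ?_ ?_
  · rwa [fr.map_map hU] at h
  · rintro _ ⟨u, hu, rfl⟩
    rw [fr.T_map (hU hu), hvU u hu]
  · rwa [fr.T_map hv]

/-- The vectors of the hyperline of `z` orthogonal to `U`. -/
lemma finrank_perp (fr : P.Frame d z) {U : Submodule F V} (hU : U ≤ P.hyper z) :
    ∃ U' ≤ P.hyper z, (∀ v, v ∈ U' ↔ v ∈ P.hyper z ∧ ∀ u ∈ U, P.T (P.cr d u) v = 0) ∧
      Module.finrank F U' + Module.finrank F U = 10 := by
  have := P.finiteDimensional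
  let B : LinearMap.BilinForm F (P.hyper z) :=
    (P.T ∘ₗ P.cr d).compl₁₂ (P.hyper z).subtype (P.hyper z).subtype
  have hB : ∀ x y, B x y = P.T (P.cr d x) y := fun x y => rfl
  have hrefl : B.IsRefl := fun x y h => by
    rwa [hB, P.T_cr_swap, ← hB] at h
  have hnd : B.Nondegenerate := by
    refine hrefl.nondegenerate_iff_separatingLeft.2 fun x hx => ?_
    have h : P.cr d (x : V) = 0 := by
      refine P.T_nondeg _ fun y => ?_
      have h1 := hx ⟨_, P.cr_mem_hyper z (P.cr d y)⟩
      rw [hB] at h1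
      have h2 := P.T_adj z d (P.cr d x) y
      rw [fr.cr_cr x.2] at h2
      rw [← h2, P.T_comm]
      exact h1
    have h1 := fr.cr_cr x.2
    rw [h, map_zero] at h1
    exact Subtype.ext h1.symm
  have h := LinearMap.BilinForm.finrank_orthogonal hnd (U.comap (P.hyper z).subtype)
  refine ⟨(B.orthogonal (U.comap (P.hyper z).subtype)).map (P.hyper z).subtype,
    Submodule.map_subtype_le _ _, fun v => ?_, ?_⟩
  · simp only [Submodule.mem_map, LinearMap.BilinForm.mem_orthogonal_iff, Submodule.subtype_apply,
      Submodule.mem_comap]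
    constructor
    · rintro ⟨v, hv, rfl⟩
      exact ⟨v.2, fun u hu => hv ⟨u, hU hu⟩ hu⟩
    · rintro ⟨hv, h⟩
      exact ⟨⟨v, hv⟩, fun u hu => h u hu, rfl⟩
  · have h10 : Module.finrank F (P.hyper z) = 10 := P.finrank_range z fr.ne_zero fr.right
    have h1 : Module.finrank F (U.comap (P.hyper z).subtype) = Module.finrank F U := by
      rw [← Submodule.finrank_map_subtype_eq, Submodule.map_comap_subtype, inf_eq_right.2 hU]
    have h2 := Submodule.finrank_le (U.comap (P.hyper z).subtype)
    rw [Submodule.finrank_map_subtype_eq]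
    omega

lemma finrank_le_five (fr : P.Frame d z) {U : Submodule F V} (hU : U ≤ P.hyper z)
    (h : ∀ u ∈ U, ∀ v ∈ U, P.T (P.cr d u) v = 0) : Module.finrank F U ≤ 5 := by
  have := P.finiteDimensional
  obtain ⟨U', -, h1, h2⟩ := fr.finrank_perp hU
  have := Submodule.finrank_mono (show U ≤ U' from fun v hv =>
    (h1 v).2 ⟨hU hv, fun u hu => h u hu v hv⟩)
  omega

lemma exists_anisotropic (fr : P.Frame d z) {U : Submodule F V} (hU : U ≤ P.hyper z)
    (h4 : Module.finrank F U ≤ 4) :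
    ∃ v ∈ P.hyper z, (∀ u ∈ U, P.T (P.cr d u) v = 0) ∧ P.T (P.cr d v) v ≠ 0 := by
  have := P.finiteDimensional
  obtain ⟨U', hU', h1, h2⟩ := fr.finrank_perp hU
  by_contra! hcon
  have h0 : ∀ v ∈ U', P.T (P.cr d v) v = 0 := fun v hv =>
    hcon v ((h1 v).1 hv).1 ((h1 v).1 hv).2
  have := fr.finrank_le_five hU' fun u hu v hv => by
    have h3 := h0 _ (U'.add_mem hu hv)
    simp only [map_add, LinearMap.add_apply] at h3
    rw [h0 u hu, h0 v hv, P.T_cr_swap d v u, zero_add, add_zero, ← two_mul] at h3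
    exact (mul_eq_zero.1 h3).resolve_left P.two_ne
  omega

end Frame

end CubicSpace

namespace CubicSpace

variable {F : Type*} {V : Type*} [Field F] [AddCommGroup V] [Module F V]
  {P : CubicSpace F V} {d z : V}

lemma TS.T_eq_zero {U : Submodule F V} (h : P.TS U) {u v : V} (hu : u ∈ U) (hv : v ∈ U) (d : V) :
    P.T (P.cr d u) v = 0 := by
  rw [P.T_cr, h.cr_eq_zero hu hv, map_zero]

/-- Two vectors spanning a plane have no common multiples. -/
lemma eq_zero_of_forall_mem_span {U : Submodule F V} (hU : 2 ≤ Module.finrank F U) {x : V}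
    (h : ∀ w ∈ U, w ≠ 0 → x ∈ Submodule.span F {w}) : x = 0 := by
  by_contra hx
  have hle : U ≤ Submodule.span F {x} := by
    intro w hw
    by_cases hw0 : w = 0
    · rw [hw0]; exact zero_mem _
    obtain ⟨c, rfl⟩ := Submodule.mem_span_singleton.1 (h w hw hw0)
    have hc : c ≠ 0 := fun hc => hx (by rw [hc, zero_smul])
    exact Submodule.mem_span_singleton.2 ⟨c⁻¹, by rw [smul_smul, inv_mul_cancel₀ hc, one_smul]⟩
  have h1 := Submodule.finrank_mono hle
  rw [finrank_span_singleton hx] at h1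
  omega

namespace Frame


lemma finrank_le_five_of_TS (fr : P.Frame d z) {U : Submodule F V} (hU : U ≤ P.hyper z)
    (h : P.TS U) :
    Module.finrank F U ≤ 5 :=
  fr.finrank_le_five hU fun _ hu _ hv => h.T_eq_zero hu hv d

lemma exists_finrank_kerL_add (fr : P.Frame d z) {U : Submodule F V} (hU : U ≤ P.hyper z)
    (h : P.TS U) {m : ℕ}
    (hm : Module.finrank F U = m + 1) :
    ∃ U' ≤ U, Module.finrank F U' = m ∧ Module.finrank F (P.kerL d z U')
      = Module.finrank F (P.kerL d z U) + Module.finrank F (P.kerL z d (U.map (P.cr d))) := by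
  have := P.finiteDimensional
  obtain ⟨w, hw, hw0⟩ := exists_ne_zero_of_finrank_eq_succ hm
  obtain ⟨U', hwU', rfl, hm'⟩ := exists_sup_span_singleton hm hw hw0
  obtain ⟨k, hkw, hkU⟩ := exists_form_eq_one P.T P.T_nondeg hwU'
  have hT : ∀ u ∈ P.hyper z, P.T (P.cr d u) (P.cr z k) = P.T k u := fun u hu => by
    rw [P.T_comm, P.T_cr_swap, fr.cr_cr hu, P.T_comm]
  refine ⟨U', le_sup_left, hm', fr.finrank_kerL_sup (le_sup_left.trans hU) (hU hw)
    (P.cr_mem_hyper z k) (h.T_eq_zero hw hw d)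
    (fun u hu => h.T_eq_zero (Submodule.mem_sup_left hu) hw d) (fun u hu => ?_) ?_⟩
  · rw [hT u (hU (Submodule.mem_sup_left hu)), hkU u hu]
  · rw [hT w (hU hw), hkw]

lemma finrank_kerL (fr : P.Frame d z) {m : ℕ} (hm4 : m ≤ 4) :
    ∀ {U : Submodule F V}, U ≤ P.hyper z → P.TS U →
    Module.finrank F U = m → Module.finrank F (P.kerL d z U) = 2 ^ (4 - m) ∧
      Module.finrank F (P.kerL z d (U.map (P.cr d))) = 2 ^ (4 - m) := by
  have := P.finiteDimensional
  induction m with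
  | zero =>
    intro U hU h hm
    rw [Submodule.finrank_eq_zero.1 hm, Submodule.map_bot, kerL_bot, kerL_bot, fr.finrank_half,
      fr.symm.finrank_half]
    norm_num
  | succ m ih =>
    intro U hU h hm
    obtain ⟨U', hle, hm', hadd⟩ := fr.exists_finrank_kerL_add hU h hm
    obtain ⟨v, hv, hvU, hvv⟩ := fr.exists_anisotropic hU (by omega)
    have h1 := fr.finrank_kerL_eq hU hv hvU hvv
    have h2 := (ih (by omega) (hle.trans hU) (h.mono hle) hm').1
    have h3 : 2 ^ (4 - m) = 2 * 2 ^ (4 - (m + 1)) := by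
      rw [← pow_succ']; congr 1; omega
    omega

lemma finrank_kerL_five (fr : P.Frame d z) {U : Submodule F V} (hU : U ≤ P.hyper z) (h : P.TS U)
    (hm : Module.finrank F U = 5) : Module.finrank F (P.kerL d z U)
      + Module.finrank F (P.kerL z d (U.map (P.cr d))) = 1 := by
  obtain ⟨U', hle, hm', hadd⟩ := fr.exists_finrank_kerL_add hU h hm
  rw [← hadd, (fr.finrank_kerL le_rfl (hle.trans hU) (h.mono hle) hm').1]
  norm_num

lemma dual_eq (fr : P.Frame d z) {U : Submodule F V} (hU : U ≤ P.hyper z) (h : P.TS U)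
    (h2 : 2 ≤ Module.finrank F U) :
    P.dual U = P.kerL z d (U.map (P.cr d)) ⊔ Submodule.span F {z} := by
  have := P.finiteDimensional
  have hz0 := fr.ne_zero
  apply le_antisymm
  · intro y hy
    have hyU : ∀ w ∈ U, w ≠ 0 → y ∈ P.hyper w := fun w hw hw0 =>
      mem_hyper_of_mem_dual hy hw (h w hw) hw0
    have hzy : P.cr z y = 0 := by
      refine eq_zero_of_forall_mem_span h2 fun w hw hw0 => ?_
      obtain ⟨k, rfl⟩ := hyU w hw hw0
      rw [P.cr_hyper_cr fr.right (hU hw)]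
      exact Submodule.smul_mem _ _ (Submodule.mem_span_singleton_self w)
    have ht : y - P.T y d • z ∈ P.kerL z d (U.map (P.cr d)) := by
      refine ⟨mem_half.2 ⟨?_, ?_⟩, ?_⟩
      · rw [map_sub, map_smul, fr.one, P.T_comm d]; simp
      · rw [map_sub, map_smul, fr.right, hzy]; simp
      · rintro _ ⟨w, hw, rfl⟩
        rw [map_sub, map_smul, P.cr_comm _ z, fr.cr_cr (hU hw)]
        by_cases hw0 : w = 0
        · simp [hw0]
        · obtain ⟨k, hk⟩ := hyU w hw hw0
          have h1 := P.cr_cr_cr (h w hw) d k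
          rw [hk, P.cr_comm w d, P.T_cr, hk, P.T_comm d] at h1
          rw [h1, sub_self]
    have := Submodule.add_mem_sup ht
      (Submodule.smul_mem _ (P.T y d) (Submodule.mem_span_singleton_self z))
    rwa [sub_add_cancel] at this
  · refine sup_le (fun t ht w hw => ?_) ?_
    · by_cases hw0 : w = 0
      · rw [hw0]; exact (inc_zero t).symm
      rw [inc_iff_mem_hyper (h w hw) hw0]
      have hwz : ∃ k, P.T w k = 1 := by
        obtain ⟨k, hk⟩ := P.exists_T_eq_one hw0
        exact ⟨k, by rw [P.T_comm, hk]⟩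
      obtain ⟨k, hk⟩ := hwz
      have h1 := fr.clifford_dual (hU hw) (P.cr_mem_hyper z k) ht.1
      rw [ht.2 _ ⟨w, hw, rfl⟩, map_zero, add_zero, P.T_comm (P.cr d w), P.T_cr_swap,
        fr.cr_cr (hU hw), hk, one_smul] at h1
      rw [← h1]
      exact P.cr_mem_hyper _ _
    · rw [Submodule.span_singleton_le_iff_mem]
      exact mem_dual_of_le_hyper hU fr.right fr.ne_zero

lemma finrank_dual_eq (fr : P.Frame d z) {U : Submodule F V} (hU : U ≤ P.hyper z) (h : P.TS U)
    (h2 : 2 ≤ Module.finrank F U) :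
    Module.finrank F (P.dual U) = Module.finrank F (P.kerL z d (U.map (P.cr d))) + 1 := by
  have := P.finiteDimensional
  rw [fr.dual_eq hU h h2, Submodule.finrank_sup_span_singleton]
  intro hz
  have h1 := (mem_half.1 hz.1).1
  rw [fr.one] at h1
  exact one_ne_zero h1

end Frame

lemma finrank_dual_of_le_hyper {U : Submodule F V} (hz : P.cr z z = 0) (hz0 : z ≠ 0)
    (hU : U ≤ P.hyper z) (h : P.TS U) (h2 : 2 ≤ Module.finrank F U)
    (h4 : Module.finrank F U ≤ 4) :
    Module.finrank F (P.dual U) = 2 ^ (4 - Module.finrank F U) + 1 := by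
  obtain ⟨d, fr⟩ := exists_frame hz hz0
  rw [fr.finrank_dual_eq hU h h2, (fr.finrank_kerL h4 hU h rfl).2]

lemma finrank_le_five_of_le_hyper {U : Submodule F V} (hz : P.cr z z = 0) (hz0 : z ≠ 0)
    (hU : U ≤ P.hyper z) (h : P.TS U) : Module.finrank F U ≤ 5 := by
  obtain ⟨d, fr⟩ := exists_frame hz hz0
  exact fr.finrank_le_five_of_TS hU h

end CubicSpace

namespace CubicSpace

variable {F : Type*} {V : Type*} [Field F] [AddCommGroup V] [Module F V]
  {P : CubicSpace F V} {d z : V}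

lemma TS.dual {W : Submodule F V} (h : P.TS W) (h2 : 2 ≤ Module.finrank F W) :
    P.TS (P.dual W) := by
  intro y hy
  refine eq_zero_of_forall_mem_span h2 fun w hw hw0 => ?_
  obtain ⟨k, rfl⟩ := mem_hyper_of_mem_dual hy hw (h w hw) hw0
  rw [P.cr_cr_cr (h w hw)]
  exact Submodule.smul_mem _ _ (Submodule.mem_span_singleton_self w)

lemma mem_dual_sup_span {W : Submodule F V} {x y : V} (hy : y ∈ P.dual W) (hx : P.Inc x y) :
    y ∈ P.dual (W ⊔ Submodule.span F {x} : Submodule F V) := by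
  intro w hw
  obtain ⟨u, hu, x', hx', rfl⟩ := Submodule.mem_sup.1 hw
  obtain ⟨c, rfl⟩ := Submodule.mem_span_singleton.1 hx'
  exact ((hy u hu).symm.add (hx.symm.smul c)).symm

/-- The vectors of the hyperline of `z` annihilated by `s`. -/
def ann (P : CubicSpace F V) (z s : V) : Submodule F V := P.hyper z ⊓ LinearMap.ker (P.cr s)

lemma mem_ann {s v : V} : v ∈ P.ann z s ↔ v ∈ P.hyper z ∧ P.cr s v = 0 := Iff.rfl

namespace Frame


lemma exists_half_complement (fr : P.Frame d z) {W : Submodule F V} (h : P.TS W) (hd : d ∈ W) :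
    ∃ W' ≤ W, W' ≤ P.half d z ∧ W = W' ⊔ Submodule.span F {d} ∧
      Module.finrank F W = Module.finrank F W' + 1 := by
  have := P.finiteDimensional
  have hW : W = (W ⊓ LinearMap.ker (P.T z)) ⊔ Submodule.span F {d} := by
    apply le_antisymm
    · intro w hw
      have h1 : w - P.T z w • d ∈ W ⊓ LinearMap.ker (P.T z) := by
        refine ⟨W.sub_mem hw (W.smul_mem _ hd), LinearMap.mem_ker.2 ?_⟩
        rw [map_sub, map_smul, fr.symm.one]
        simp
      have h2 := Submodule.add_mem_sup h1
        (Submodule.smul_mem _ (P.T z w) (Submodule.mem_span_singleton_self d))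
      rwa [sub_add_cancel] at h2
    · exact sup_le inf_le_left ((Submodule.span_singleton_le_iff_mem _ _).2 hd)
  refine ⟨W ⊓ LinearMap.ker (P.T z), inf_le_left, fun s hs => mem_half.2 ⟨hs.2, ?_⟩, hW, ?_⟩
  · rw [h.cr_eq_zero hd hs.1, map_zero]
  · conv_lhs => rw [hW]
    refine Submodule.finrank_sup_span_singleton fun hd' => ?_
    have h1 := LinearMap.mem_ker.1 hd'.2
    rw [fr.symm.one] at h1
    exact one_ne_zero h1

lemma ann_isotropic (fr : P.Frame d z) {s : V} (hs : s ∈ P.half d z) (hs0 : s ≠ 0) {u v : V}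
    (hu : u ∈ P.ann z s)
    (hv : v ∈ P.ann z s) : P.T (P.cr d u) v = 0 := by
  have h := fr.clifford hu.1 hv.1 hs
  rw [P.cr_comm v, P.cr_comm u, (mem_ann.1 hu).2, (mem_ann.1 hv).2, map_zero, map_zero,
    add_zero] at h
  exact (smul_eq_zero.1 h.symm).resolve_right hs0

lemma finrank_ann (fr : P.Frame d z) {s : V} (hs : s ∈ P.half d z) (hs0 : s ≠ 0)
    (hss : P.cr s s = 0) :
    Module.finrank F (P.ann z s) = 5 := by
  have := P.finiteDimensional
  have h1 : Module.finrank F (P.ann z s) ≤ 5 :=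
    fr.finrank_le_five inf_le_left fun u hu v hv => fr.ann_isotropic hs hs0 hu hv
  have h2 := finrank_eq_inf_ker_add_map (P.cr s) (P.hyper z)
  have h3 : Module.finrank F ((P.hyper z).map (P.cr s)) ≤ 5 := by
    refine finrank_le_five_of_le_hyper hss hs0 (Frame.map_le_hyper _) ?_
    rintro _ ⟨v, hv, rfl⟩
    rw [P.cr_cr_cr hss, P.T_cr]
    obtain ⟨k, hk⟩ := hv
    have h4 := P.hyper_cr_cr fr.right ⟨k, hk⟩ k
    rw [hk] at h4
    rw [h4, map_smul, P.T_comm s, (mem_half.1 hs).1, smul_zero, zero_smul]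
  have h10 : Module.finrank F (P.hyper z) = 10 := P.finrank_range z fr.ne_zero fr.right
  change Module.finrank F (P.hyper z) = Module.finrank F (P.ann z s) + _ at h2
  omega

lemma cr_mem_dual (fr : P.Frame d z) {W' : Submodule F V} (hW' : W' ≤ P.half d z) {v : V}
    (h : ∀ s ∈ W', P.cr s v = 0) :
    P.cr d v ∈ P.dual (W' ⊔ Submodule.span F {d} : Submodule F V) := by
  have hd0 := fr.symm.ne_zero
  refine mem_dual_sup_span (fun s hs k => ?_)
    ((inc_iff_mem_hyper fr.left hd0).2 (P.cr_mem_hyper d v))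
  have h1 := P.quartic d v s k
  rw [fr.cr_half (hW' hs), P.cr_comm v s, h s hs, fr.T_cr_half (hW' hs)] at h1
  rw [P.T_comm s, fr.T_cr_half (hW' hs), P.T_comm k]
  simpa using h1

lemma false_of_ann_inf_eq_bot (fr : P.Frame d z) {s₁ s₂ : V} (h₁ : s₁ ∈ P.half d z)
    (h₂ : s₂ ∈ P.half d z)
    (h₁0 : s₁ ≠ 0) (h₂0 : s₂ ≠ 0) (h₃0 : s₁ + s₂ ≠ 0) (h11 : P.cr s₁ s₁ = 0)
    (h22 : P.cr s₂ s₂ = 0) (h12 : P.cr s₁ s₂ = 0) (h : P.ann z s₁ ⊓ P.ann z s₂ = ⊥) :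
    False := by
  have := P.finiteDimensional
  have h33 : P.cr (s₁ + s₂) (s₁ + s₂) = 0 := by simp [h11, h22, h12, P.cr_comm s₂ s₁]
  have h₃ := (P.half d z).add_mem h₁ h₂
  have hN₁ := fr.finrank_ann h₁ h₁0 h11
  have hN₂ := fr.finrank_ann h₂ h₂0 h22
  have hN₃ := fr.finrank_ann h₃ h₃0 h33
  have hsup : P.ann z s₁ ⊔ P.ann z s₂ = P.hyper z := by
    refine Submodule.eq_of_le_of_finrank_eq (sup_le inf_le_left inf_le_left) ?_
    have h1 := Submodule.finrank_sup_add_finrank_inf_eq (P.ann z s₁) (P.ann z s₂)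
    have h10 : Module.finrank F (P.hyper z) = 10 := P.finrank_range z fr.ne_zero fr.right
    rw [h, finrank_bot] at h1
    omega
  refine false_of_three_isotropic P.two_ne (P.T ∘ₗ P.cr d) (fun x y => P.T_cr_swap d x y)
    (n := 5) ⟨2, rfl⟩ (N₁ := P.ann z s₁) (N₂ := P.ann z s₂) (N₃ := P.ann z (s₁ + s₂))
    (fun u hu v hv => fr.ann_isotropic h₁ h₁0 hu hv)
    (fun u hu v hv => fr.ann_isotropic h₂ h₂0 hu hv)
    (fun u hu v hv => fr.ann_isotropic h₃ h₃0 hu hv) hN₂ hN₃ h ?_ ?_ ?_ ?_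
  · rw [eq_bot_iff, ← h]
    rintro v ⟨hv₁, hv₃⟩
    have h3 := (mem_ann.1 hv₃).2
    rw [map_add, LinearMap.add_apply, (mem_ann.1 hv₁).2, zero_add] at h3
    exact ⟨hv₁, hv₁.1, h3⟩
  · rw [eq_bot_iff, ← h]
    rintro v ⟨hv₂, hv₃⟩
    have h3 := (mem_ann.1 hv₃).2
    rw [map_add, LinearMap.add_apply, (mem_ann.1 hv₂).2, add_zero] at h3
    exact ⟨⟨hv₂.1, h3⟩, hv₂⟩
  · rw [hsup]
    exact inf_le_left
  · intro x hx hxy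
    have hall : ∀ y ∈ P.hyper z, P.T (P.cr d x) y = 0 := by
      intro y hy
      rw [← hsup] at hy
      obtain ⟨u, hu, v, hv, rfl⟩ := Submodule.mem_sup.1 hy
      have h2 : P.T (P.cr d x) v = 0 := hxy v hv
      rw [map_add, fr.ann_isotropic h₁ h₁0 hx hu, h2, add_zero]
    refine P.T_nondeg x fun k => ?_
    rw [← fr.cr_cr hx.1, P.T_cr_swap, P.T_comm]
    exact hall _ (P.cr_mem_hyper z k)

end Frame

lemma TS.exists_mem_dual {W : Submodule F V} (h : P.TS W)
    (hW : Module.finrank F W = 2 ∨ Module.finrank F W = 3) : ∃ y ∈ P.dual W, y ≠ 0 := by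
  have := P.finiteDimensional
  obtain ⟨d, hd, hd0⟩ := exists_ne_zero_of_finrank_eq_succ (U := W)
    (m := Module.finrank F W - 1) (by omega)
  obtain ⟨z, fr'⟩ := exists_frame (h d hd) hd0
  have fr := fr'.symm
  obtain ⟨W', hle, hhalf, hW', hfin⟩ := fr.exists_half_complement h hd
  suffices hs : ∃ v ∈ P.hyper z, v ≠ 0 ∧ ∀ s ∈ W', P.cr s v = 0 by
    obtain ⟨v, hv, hv0, hs⟩ := hs
    refine ⟨P.cr d v, hW' ▸ fr.cr_mem_dual hhalf hs, fun h0 => hv0 ?_⟩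
    rw [← fr.cr_cr hv, h0, map_zero]
  rcases hW with hW | hW
  · obtain ⟨s, hs, hs0⟩ := exists_ne_zero_of_finrank_eq_succ (U := W') (m := 0) (by omega)
    obtain ⟨v, hv, hv0⟩ := exists_ne_zero_of_finrank_eq_succ
      (fr.finrank_ann (hhalf hs) hs0 (h s (hle hs)))
    refine ⟨v, hv.1, hv0, fun t ht => ?_⟩
    obtain ⟨c, hc⟩ := (finrank_eq_one_iff_of_nonzero' (⟨s, hs⟩ : W')
      (fun h0 => hs0 (congrArg Subtype.val h0))).1
      (show Module.finrank F W' = 1 by omega) ⟨t, ht⟩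
    have hc' : c • s = t := congrArg Subtype.val hc
    rw [← hc', map_smul, LinearMap.smul_apply, (mem_ann.1 hv).2, smul_zero]
  · obtain ⟨s, hs, hs0⟩ := exists_ne_zero_of_finrank_eq_succ (U := W') (m := 1) (by omega)
    obtain ⟨U, hsU, rfl, hU⟩ := exists_sup_span_singleton (m := 1) (by omega) hs hs0
    obtain ⟨t, ht, ht0⟩ := exists_ne_zero_of_finrank_eq_succ hU
    have ht' := Submodule.mem_sup_left (T := Submodule.span F {s}) ht
    have hne : P.ann z s ⊓ P.ann z t ≠ ⊥ := fun hbot =>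
      fr.false_of_ann_inf_eq_bot (hhalf hs) (hhalf ht') hs0 ht0
        (fun h0 => hsU (by rw [eq_neg_of_add_eq_zero_left h0]; exact U.neg_mem ht))
        (h s (hle hs)) (h t (hle ht')) (h.cr_eq_zero (hle hs) (hle ht')) hbot
    obtain ⟨v, ⟨hv, hv'⟩, hv0⟩ := (Submodule.ne_bot_iff _).1 hne
    refine ⟨v, hv.1, hv0, fun x hx => ?_⟩
    obtain ⟨u, hu, y, hy, rfl⟩ := Submodule.mem_sup.1 hx
    obtain ⟨c, rfl⟩ := Submodule.mem_span_singleton.1 hy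
    obtain ⟨c', hc'⟩ := (finrank_eq_one_iff_of_nonzero' (⟨t, ht⟩ : U)
      (fun h0 => ht0 (congrArg Subtype.val h0))).1 hU ⟨u, hu⟩
    have hc'' : c' • t = u := congrArg Subtype.val hc'
    rw [← hc'', map_add, map_smul, map_smul, LinearMap.add_apply, LinearMap.smul_apply,
      LinearMap.smul_apply, (mem_ann.1 hv).2, (mem_ann.1 hv').2, smul_zero, smul_zero, add_zero]

lemma TS.finrank_dual_of_mem {W : Submodule F V} (h : P.TS W) (h2 : 2 ≤ Module.finrank F W)
    (h4 : Module.finrank F W ≤ 4) (hy : ∃ y ∈ P.dual W, y ≠ 0) :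
    Module.finrank F (P.dual W) = 2 ^ (4 - Module.finrank F W) + 1 := by
  obtain ⟨z, hz, hz0⟩ := hy
  have hzz := h.dual h2 z hz
  exact finrank_dual_of_le_hyper hzz hz0 (le_hyper_of_mem_dual hz hzz hz0) h h2 h4

/-- If the duals of subspaces of dimensions `m` and `m + 1` have dimensions `a` and `b` with
`a < 2 * b`, then the duals of subspaces of dimension `m + 2` are nonzero. -/
lemma TS.exists_mem_dual_of_finrank {W : Submodule F V} (h : P.TS W) {m a b : ℕ}
    (hW : Module.finrank F W = m + 2)
    (ha : ∀ U : Submodule F V, P.TS U → Module.finrank F U = m →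
      Module.finrank F (P.dual U) = a)
    (hb : ∀ U : Submodule F V, P.TS U → Module.finrank F U = m + 1 →
      Module.finrank F (P.dual U) = b) (hab : a < 2 * b) : ∃ y ∈ P.dual W, y ≠ 0 := by
  have := P.finiteDimensional
  obtain ⟨x, hx, hx0⟩ := exists_ne_zero_of_finrank_eq_succ (m := m + 1) hW
  obtain ⟨W', hxW', rfl, hW'⟩ := exists_sup_span_singleton (m := m + 1) hW hx hx0
  obtain ⟨y, hy, hy0⟩ := exists_ne_zero_of_finrank_eq_succ hW'
  obtain ⟨U, -, hU, hUm⟩ := exists_sup_span_singleton hW' hy hy0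
  have hUW' : U ≤ W' := hU ▸ le_sup_left
  have hU1 : Module.finrank F (U ⊔ Submodule.span F {x} : Submodule F V) = m + 1 := by
    rw [Submodule.finrank_sup_span_singleton fun hxU => hxW' (hUW' hxU), hUm]
  have h1 := hb _ (h.mono le_sup_left) hW'
  have h2 := hb _ (h.mono (sup_le_sup_right hUW' _)) hU1
  have h3 := ha _ (h.mono (hUW'.trans le_sup_left)) hUm
  have h4 := Submodule.finrank_sup_add_finrank_inf_eq (P.dual W')
    (P.dual (U ⊔ Submodule.span F {x} : Submodule F V))
  have h5 := Submodule.finrank_mono (sup_le (dual_anti (P := P) (SetLike.coe_subset_coe.2 hUW'))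
    (dual_anti (P := P) (SetLike.coe_subset_coe.2 (le_sup_left (a := U)
      (b := Submodule.span F {x})))))
  obtain ⟨v, ⟨hv, hv'⟩, hv0⟩ := exists_ne_zero_of_finrank_eq_succ (U := P.dual W' ⊓
    P.dual (U ⊔ Submodule.span F {x} : Submodule F V)) (m := 2 * b - a - 1 +
      (Module.finrank F (P.dual W' ⊓ P.dual (U ⊔ Submodule.span F {x} : Submodule F V) :
        Submodule F V) - (2 * b - a))) (by omega)
  exact ⟨v, mem_dual_sup_span hv
    (hv' x (Submodule.mem_sup_right (Submodule.mem_span_singleton_self x))), hv0⟩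

lemma TS.finrank_dual_two {W : Submodule F V} (h : P.TS W) (hW : Module.finrank F W = 2) :
    Module.finrank F (P.dual W) = 5 := by
  rw [h.finrank_dual_of_mem (by omega) (by omega) (h.exists_mem_dual (Or.inl hW)), hW]
  norm_num

lemma TS.finrank_dual_three {W : Submodule F V} (h : P.TS W) (hW : Module.finrank F W = 3) :
    Module.finrank F (P.dual W) = 3 := by
  rw [h.finrank_dual_of_mem (by omega) (by omega) (h.exists_mem_dual (Or.inr hW)), hW]
  norm_num

lemma TS.finrank_dual_four {W : Submodule F V} (h : P.TS W) (hW : Module.finrank F W = 4) :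
    Module.finrank F (P.dual W) = 2 := by
  rw [h.finrank_dual_of_mem (by omega) (by omega) (h.exists_mem_dual_of_finrank hW
    (fun _ => TS.finrank_dual_two) (fun _ => TS.finrank_dual_three) (by omega)), hW]
  norm_num

lemma TS.exists_mem_dual_five {W : Submodule F V} (h : P.TS W) (hW : Module.finrank F W = 5) :
    ∃ y ∈ P.dual W, y ≠ 0 :=
  h.exists_mem_dual_of_finrank hW (fun _ => TS.finrank_dual_three)
    (fun _ => TS.finrank_dual_four) (by omega)

end CubicSpace

namespace CubicSpace

variable {F : Type*} {V : Type*} [Field F] [AddCommGroup V] [Module F V]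
  {P : CubicSpace F V} {d z : V}

/-- Maximal totally singular subspaces. -/
def MaxTS (P : CubicSpace F V) (W : Submodule F V) : Prop :=
  P.TS W ∧ ∀ W' : Submodule F V, P.TS W' → W ≤ W' → W' = W

lemma TS.dual_dual_three {W : Submodule F V} (h : P.TS W) (hW : Module.finrank F W = 3) :
    P.dual (P.dual W) = W := by
  have := P.finiteDimensional
  have h1 := (h.dual (by omega)).finrank_dual_three (h.finrank_dual_three hW)
  exact (Submodule.eq_of_le_of_finrank_eq (le_dual_dual (P := P) (W : Set V))
    (hW.trans h1.symm)).symm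

lemma TS.dual_dual_two {W : Submodule F V} (h : P.TS W) (hW : Module.finrank F W = 2) :
    P.dual (P.dual W) = W := by
  have := P.finiteDimensional
  have hD := h.finrank_dual_two hW
  have hDTS := h.dual (by omega)
  obtain ⟨x, hx, hx0⟩ := exists_ne_zero_of_finrank_eq_succ hD
  obtain ⟨U, -, hU, hU4⟩ := exists_sup_span_singleton hD hx hx0
  have hUD : U ≤ P.dual W := hU ▸ le_sup_left
  have h1 : P.dual (P.dual W) ≤ P.dual U := dual_anti (SetLike.coe_subset_coe.2 hUD)
  have h2 := (hDTS.mono hUD).finrank_dual_four hU4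
  have h3 := Submodule.finrank_mono h1
  exact (Submodule.eq_of_le_of_finrank_le (le_dual_dual (P := P) (W : Set V))
    (by omega)).symm

lemma TS.maxTS_of_finrank_dual {D : Submodule F V} (h : P.TS D) (hD : Module.finrank F D = 5)
    (hd2 : Module.finrank F (P.dual D) = 2) : P.MaxTS D := by
  have := P.finiteDimensional
  refine ⟨h, fun W hW hle => ?_⟩
  obtain ⟨d, hd, hd0⟩ := exists_ne_zero_of_finrank_eq_succ hd2
  have hdd := h.dual (by omega) d hd
  have hDd := le_hyper_of_mem_dual hd hdd hd0
  obtain ⟨e, fr⟩ := exists_frame hdd hd0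
  have hker : P.kerL e d D = ⊥ := by
    have h1 := fr.finrank_kerL_five hDd h hD
    have h2 := fr.finrank_dual_eq hDd h (by omega)
    exact Submodule.finrank_eq_zero.1 (by omega)
  have hWd : W ≤ P.hyper d := by
    intro x hx
    have hTx : P.T x d = 0 := by
      obtain ⟨p, hp, hp0⟩ := exists_ne_zero_of_finrank_eq_succ hD
      have h1 := P.cr_hyper_cr hdd (hDd hp) x
      rw [hW.cr_eq_zero (hle hp) hx, map_zero] at h1
      exact (smul_eq_zero.1 h1.symm).resolve_right hp0
    have hs := fr.half_component x
    rw [hTx, zero_smul, sub_zero] at hs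
    have hsk : x - P.cr d (P.cr e x) ∈ P.kerL e d D := by
      refine ⟨hs, fun p hp => ?_⟩
      have h1 := (mem_half.1 (fr.cr_mem_half (hDd hp) hs)).1
      rw [map_sub, hW.cr_eq_zero (hle hp) hx, P.hyper_cr_cr hdd (hDd hp)] at h1 ⊢
      rw [zero_sub, map_neg, map_smul, fr.one, smul_eq_mul, mul_one, neg_eq_zero] at h1
      rw [h1, zero_smul, sub_zero]
    rw [hker, Submodule.mem_bot, sub_eq_zero] at hsk
    rw [hsk]
    exact P.cr_mem_hyper _ _
  have h5 := finrank_le_five_of_le_hyper hdd hd0 hWd hW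
  exact (Submodule.eq_of_le_of_finrank_le hle (by omega)).symm

lemma TS.maxTS_dual {W : Submodule F V} (h : P.TS W) (hW : Module.finrank F W = 2) :
    P.MaxTS (P.dual W) :=
  (h.dual (by omega)).maxTS_of_finrank_dual (h.finrank_dual_two hW)
    (by rw [h.dual_dual_two hW, hW])

lemma MaxTS.finrank_dual {W : Submodule F V} (h : P.MaxTS W) (hW : Module.finrank F W = 5) :
    Module.finrank F (P.dual W) = 2 := by
  have := P.finiteDimensional
  obtain ⟨z, hz, hz0⟩ := h.1.exists_mem_dual_five hW
  have hzz := h.1.dual (by omega) z hz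
  have hWz := le_hyper_of_mem_dual hz hzz hz0
  obtain ⟨d, fr⟩ := exists_frame hzz hz0
  have h1 := fr.finrank_kerL_five hWz h.1 hW
  rw [fr.finrank_dual_eq hWz h.1 (by omega)]
  suffices P.kerL d z W = ⊥ by
    rw [this, finrank_bot] at h1
    omega
  by_contra hne
  obtain ⟨s, hs, hs0⟩ := (Submodule.ne_bot_iff _).1 hne
  have key : ∀ w ∈ W, w ≠ 0 → P.cr s s ∈ Submodule.span F {P.cr d w} := by
    intro w hw hw0
    obtain ⟨k, hk⟩ := P.exists_T_eq_one hw0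
    have h2 := fr.clifford (hWz hw) (P.cr_mem_hyper z k) hs.1
    rw [hs.2 w hw, map_zero, add_zero, P.T_comm, P.T_cr_swap, fr.cr_cr (hWz hw), P.T_comm, hk,
      one_smul] at h2
    have h3 : P.cr (P.cr d w) (P.cr d w) = 0 := by
      rw [P.cr_cr_cr fr.left, h.1.T_eq_zero hw hw, zero_smul]
    have h4 := P.cr_cr_cr h3 (P.cr (P.cr z k) s) (P.cr (P.cr z k) s)
    rw [h2] at h4
    rw [h4]
    exact Submodule.smul_mem _ _ (Submodule.mem_span_singleton_self _)
  have hzss : P.cr z (P.cr s s) = 0 := by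
    refine eq_zero_of_forall_mem_span (U := W) (by omega) fun w hw hw0 => ?_
    obtain ⟨c, hc⟩ := Submodule.mem_span_singleton.1 (key w hw hw0)
    rw [← hc, map_smul, fr.cr_cr (hWz hw)]
    exact Submodule.smul_mem _ _ (Submodule.mem_span_singleton_self _)
  have hss : P.cr s s = 0 := by
    obtain ⟨w, hw, hw0⟩ := exists_ne_zero_of_finrank_eq_succ hW
    obtain ⟨c, hc⟩ := Submodule.mem_span_singleton.1 (key w hw hw0)
    have h2 : P.cr s s ∈ P.hyper d := hc ▸ Submodule.smul_mem _ c (P.cr_mem_hyper d w)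
    rw [← fr.symm.cr_cr h2, hzss, map_zero]
  have hW' := h.2 _ (h.1.sup_span hss hs.2) le_sup_left
  have hsW : s ∈ W := hW' ▸ Submodule.mem_sup_right (Submodule.mem_span_singleton_self s)
  have h2 := fr.cr_cr (hWz hsW)
  rw [(mem_half.1 hs.1).2] at h2
  exact hs0 h2.symm

lemma MaxTS.dual_dual {W : Submodule F V} (h : P.MaxTS W) (hW : Module.finrank F W = 5) :
    P.dual (P.dual W) = W := by
  have := P.finiteDimensional
  have h2 := (h.1.dual (by omega)).finrank_dual_two (h.finrank_dual hW)
  exact (Submodule.eq_of_le_of_finrank_eq (le_dual_dual (P := P) (W : Set V))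
    (hW.trans h2.symm)).symm

lemma TS.exists_eq_span {W : Submodule F V} (h : P.TS W) (hW : Module.finrank F W = 1) :
    ∃ d, d ≠ 0 ∧ P.cr d d = 0 ∧ W = Submodule.span F {d} := by
  have := P.finiteDimensional
  obtain ⟨d, hd, hd0⟩ := exists_ne_zero_of_finrank_eq_succ (m := 0) hW
  exact ⟨d, hd0, h d hd, (Submodule.eq_of_le_of_finrank_eq
    ((Submodule.span_singleton_le_iff_mem _ _).2 hd) (by rw [hW, finrank_span_singleton hd0])).symm⟩

lemma TS_span_singleton {d : V} (hd : P.cr d d = 0) : P.TS (Submodule.span F {d}) := by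
  intro x hx
  obtain ⟨c, rfl⟩ := Submodule.mem_span_singleton.1 hx
  simp [hd]

end CubicSpace

namespace OctonionAlgebra

variable {F : Type u} [Field F] (O : OctonionAlgebra.{u, v} F)

/-- The polar form of the norm. -/
def b : O.C →ₗ[F] O.C →ₗ[F] F := QuadraticMap.polarBilin O.n

lemma b_apply (x y : O.C) : O.b x y = O.n (x + y) - O.n x - O.n y := rfl

lemma n_add (x y : O.C) : O.n (x + y) = O.n x + O.n y + O.b x y := by
  rw [b_apply]; ring

lemma n_smul (c : F) (x : O.C) : O.n (c • x) = c ^ 2 * O.n x := by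
  rw [QuadraticMap.map_smul, smul_eq_mul, pow_two]

lemma b_comm (x y : O.C) : O.b x y = O.b y x := by
  rw [b_apply, b_apply, add_comm x y]; ring

lemma b_self (x : O.C) : O.b x x = 2 * O.n x := by
  rw [b_apply, ← two_smul F x, n_smul]; ring

lemma ext_b {x y : O.C} (h : ∀ w, O.b x w = O.b y w) : x = y :=
  sub_eq_zero.1 (O.nondeg _ fun w => by
    change O.b (x - y) w = 0
    rw [map_sub, LinearMap.sub_apply, h, sub_self])

lemma conj_eq (x : O.C) : O.conj x = O.b x 1 • (1 : O.C) - x := rfl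

lemma b_mul_left (x y z : O.C) : O.b (x * y) (x * z) = O.n x * O.b y z := by
  rw [b_apply, b_apply, ← mul_add, O.n_mul, O.n_mul, O.n_mul]; ring

lemma b_mul_right (x y z : O.C) : O.b (x * y) (z * y) = O.b x z * O.n y := by
  rw [b_apply, b_apply, ← add_mul, O.n_mul, O.n_mul, O.n_mul]; ring

lemma b_mul_mul (x y z w : O.C) :
    O.b (x * y) (z * w) + O.b (x * w) (z * y) = O.b x z * O.b y w := by
  have h := O.b_mul_right x (y + w) z
  simp only [mul_add, map_add, LinearMap.add_apply, O.n_add] at h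
  linear_combination h - O.b_mul_right x y z - O.b_mul_right x w z

lemma b_one_one : O.b 1 1 = 2 := by rw [b_self, O.n_one, mul_one]

lemma b_mul_left_conj (x y z : O.C) : O.b (x * y) z = O.b y (O.conj x * z) := by
  have h := O.b_mul_mul x y 1 z
  rw [one_mul, one_mul] at h
  rw [conj_eq, sub_mul, smul_mul_assoc, one_mul, map_sub, map_smul, smul_eq_mul, O.b_comm y (x * z)]
  linear_combination h

lemma b_mul_right_conj (x y z : O.C) : O.b (x * y) z = O.b x (z * O.conj y) := by
  have h := O.b_mul_mul x y z 1
  rw [mul_one, mul_one] at h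
  rw [conj_eq, mul_sub, mul_smul_comm, mul_one, map_sub, map_smul, smul_eq_mul]
  linear_combination h

lemma b_conj_one (x : O.C) : O.b (O.conj x) 1 = O.b x 1 := by
  rw [conj_eq, map_sub, map_smul, LinearMap.sub_apply, LinearMap.smul_apply, b_one_one,
    smul_eq_mul]
  ring

@[simp] lemma conj_conj (x : O.C) : O.conj (O.conj x) = x := by
  rw [conj_eq (x := O.conj x), b_conj_one, conj_eq, sub_sub_cancel]

@[simp] lemma n_conj (x : O.C) : O.n (O.conj x) = O.n x := by
  have h : O.n (-x) = O.n x := by rw [← neg_one_smul F x, n_smul]; ring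
  rw [conj_eq, sub_eq_add_neg, n_add, n_smul, O.n_one, h, map_neg, map_smul, LinearMap.smul_apply,
    smul_eq_mul, O.b_comm 1 x]
  ring

lemma b_conj_conj (x y : O.C) : O.b (O.conj x) (O.conj y) = O.b x y := by
  rw [b_apply, b_apply, ← map_add, n_conj, n_conj, n_conj]

lemma b_conj_left (x y : O.C) : O.b (O.conj x) y = O.b x (O.conj y) := by
  rw [← b_conj_conj, conj_conj]

lemma b_mul_one (x y : O.C) : O.b (x * y) 1 = O.b x 1 * O.b y 1 - O.b x y := by
  rw [b_mul_right_conj, one_mul, conj_eq, map_sub, map_smul, smul_eq_mul]; ring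

lemma mul_self (x : O.C) : x * x = O.b x 1 • x - O.n x • (1 : O.C) := by
  refine O.ext_b fun w => ?_
  have h1 := O.b_mul_mul x x 1 w
  have h2 := O.b_mul_left x w 1
  rw [mul_one] at h2
  simp only [one_mul] at h1
  simp only [map_sub, map_smul, LinearMap.sub_apply, LinearMap.smul_apply, smul_eq_mul]
  rw [O.b_comm 1 w]
  linear_combination h1 - h2

lemma mul_add_mul (x y : O.C) :
    x * y + y * x = O.b x 1 • y + O.b y 1 • x - O.b x y • (1 : O.C) := by
  have h := O.mul_self (x + y)
  simp only [mul_add, add_mul, n_add, map_add, LinearMap.add_apply] at h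
  linear_combination (norm := module) h - O.mul_self x - O.mul_self y

lemma conj_mul (x y : O.C) : O.conj (x * y) = O.conj y * O.conj x := by
  rw [conj_eq, conj_eq, conj_eq, b_mul_one]
  simp only [sub_mul, mul_sub, smul_mul_assoc, mul_smul_comm, one_mul, mul_one]
  linear_combination (norm := module) -O.mul_add_mul x y

lemma conj_mul_mul (x y : O.C) : O.conj x * (x * y) = O.n x • y := by
  refine O.ext_b fun w => ?_
  rw [b_mul_left_conj, conj_conj, b_mul_left, map_smul, LinearMap.smul_apply, smul_eq_mul]

lemma mul_mul_conj (x y : O.C) : (y * x) * O.conj x = O.n x • y := by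
  refine O.ext_b fun w => ?_
  rw [b_mul_right_conj, conj_conj, b_mul_right, map_smul, LinearMap.smul_apply, smul_eq_mul,
    mul_comm]

lemma mul_conj_mul (x y : O.C) : x * (O.conj x * y) = O.n x • y := by
  have h := O.conj_mul_mul (O.conj x) y
  rwa [conj_conj, n_conj] at h

lemma mul_conj (x : O.C) : x * O.conj x = O.n x • (1 : O.C) := by
  have h := O.mul_mul_conj x 1
  rwa [one_mul] at h

lemma conj_mul_self (x : O.C) : O.conj x * x = O.n x • (1 : O.C) := by
  have h := O.conj_mul_mul x 1
  rwa [mul_one] at h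

lemma b_conj_mul_cyclic (x y z : O.C) : O.b (O.conj (x * y)) z = O.b (O.conj (z * x)) y := by
  rw [b_conj_left, b_mul_left_conj, ← conj_mul, b_comm]

lemma moufang (x y z : O.C) :
    (x * y) * (z * x) = O.b (O.conj (y * z)) x • x - O.n x • O.conj (y * z) := by
  refine O.ext_b fun w => ?_
  have h := O.b_mul_mul x y w (O.conj x * O.conj z)
  have h1 : O.b y (O.conj x * O.conj z) = O.b (O.conj (y * z)) x := by
    rw [← b_mul_left_conj, b_mul_right_conj, ← conj_mul, b_comm]
  have h2 : O.b (O.conj z) (w * y) = O.b (O.conj (y * z)) w := by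
    rw [b_comm, b_mul_right_conj, ← conj_mul, b_comm]
  rw [mul_conj_mul, h1, ← conj_mul, map_smul, LinearMap.smul_apply, smul_eq_mul, h2] at h
  simp only [map_sub, map_smul, LinearMap.sub_apply, LinearMap.smul_apply, smul_eq_mul]
  rw [b_mul_right_conj]
  linear_combination h

@[simp] lemma conj_one : O.conj 1 = 1 := by
  rw [conj_eq, b_one_one, two_smul, add_sub_cancel_right]

lemma add_conj (x : O.C) : x + O.conj x = O.b x 1 • (1 : O.C) := by
  rw [conj_eq]; abel

end OctonionAlgebra

/-- A symmetric 4-additive map with zero diagonal vanishes away from characteristics 2 and 3. -/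
lemma eq_zero_of_diag_eq_zero {F V W : Type*} [Field F] [AddCommGroup V] [AddCommGroup W]
    [Module F W] (h2 : (2 : F) ≠ 0) (h3 : (3 : F) ≠ 0) (g : V → V → V → V → W)
    (hadd : ∀ x x' y u v, g (x + x') y u v = g x y u v + g x' y u v)
    (h12 : ∀ x y u v, g x y u v = g y x u v) (h23 : ∀ x y u v, g x y u v = g x u y v)
    (h34 : ∀ x y u v, g x y u v = g x y v u) (hdiag : ∀ x, g x x x x = 0) (x y u v : V) :
    g x y u v = 0 := by
  have hadd2 : ∀ x y y' u v, g x (y + y') u v = g x y u v + g x y' u v := fun x y y' u v => by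
    rw [h12, hadd, h12 y, h12 y']
  have hadd3 : ∀ x y u u' v, g x y (u + u') v = g x y u v + g x y u' v := fun x y u u' v => by
    rw [h23, hadd2, h23 x u, h23 x u']
  have hadd4 : ∀ x y u v v', g x y u (v + v') = g x y u v + g x y u v' := fun x y u v v' => by
    rw [h34, hadd3, h34 x y v, h34 x y v']
  have hsq : ∀ x y, g x x y y = 0 := fun x y => by
    have e1 : g x x y x = g x x x y := h34 _ _ _ _
    have e2 : g x y x x = g x x x y := by rw [h23, e1]
    have e3 : g y x x x = g x x x y := by rw [h12, e2]
    have e4 : g x y x y = g x x y y := h23 _ _ _ _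
    have e5 : g x y y x = g x x y y := by rw [h34, e4]
    have e6 : g y x x y = g x x y y := by rw [h12, e4]
    have e7 : g y x y x = g x x y y := by rw [h12, e5]
    have e8 : g y y x x = g x x y y := by rw [h23, e7]
    have f1 : g y x y y = g x y y y := h12 _ _ _ _
    have f2 : g y y x y = g x y y y := by rw [h23, f1]
    have f3 : g y y y x = g x y y y := by rw [h34, f2]
    have d1 := hdiag (x + y)
    have d2 := hdiag (x + y + y)
    have d3 := hdiag (x + x + y)
    simp only [hadd, hadd2, hadd3, hadd4, hdiag, e1, e2, e3, e4, e5, e6, e7, e8, f1, f2, f3]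
      at d1 d2 d3
    have h : ((2 * 2 * 3 : F)) • g x x y y = 0 := by
      linear_combination (norm := module) (10 : F) • d1 - d2 - d3
    exact (smul_eq_zero.1 h).resolve_left (by simp [h2, h3])
  have hsq' : ∀ x u y, g x u y y = 0 := fun x u y => by
    have h := hsq (x + u) y
    simp only [hadd, hadd2, hsq, h12 u x] at h
    have h' : (2 : F) • g x u y y = 0 := by linear_combination (norm := module) h
    exact (smul_eq_zero.1 h').resolve_left h2
  have h := hsq' x y (u + v)
  simp only [hadd3, hadd4, hsq', h34 x y v u] at h
  have h' : (2 : F) • g x y u v = 0 := by linear_combination (norm := module) h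
  exact (smul_eq_zero.1 h').resolve_left h2

section FinThree

lemma fin_three_add_one_add_one (i : Fin 3) : i + 1 + 1 = i + 2 := by fin_cases i <;> rfl
lemma fin_three_add_one_add_two (i : Fin 3) : i + 1 + 2 = i := by fin_cases i <;> rfl
lemma fin_three_add_two_add_one (i : Fin 3) : i + 2 + 1 = i := by fin_cases i <;> rfl
lemma fin_three_add_two_add_two (i : Fin 3) : i + 2 + 2 = i + 1 := by fin_cases i <;> rfl

end FinThree

namespace OctonionAlgebra

variable {F : Type u} [Field F] (O : OctonionAlgebra.{u, v} F)

/-- Coordinates of hermitian `3 × 3` matrices: the diagonal and the off-diagonal entries. -/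
abbrev Coord : Type (max u v) := (Fin 3 → F) × (Fin 3 → O.C)

/-- The Freudenthal cross product in coordinates. -/
def cr : O.Coord →ₗ[F] O.Coord →ₗ[F] O.Coord :=
  LinearMap.mk₂ F (fun x y =>
    (fun i => x.1 (i + 1) * y.1 (i + 2) + x.1 (i + 2) * y.1 (i + 1) - O.b (x.2 i) (y.2 i),
      fun i => O.conj (x.2 (i + 1) * y.2 (i + 2) + y.2 (i + 1) * x.2 (i + 2))
        - x.1 i • y.2 i - y.1 i • x.2 i))
    (fun x x' y => by
      ext i
      · simp; ring
      · simp only [Prod.fst_add, Prod.snd_add, Pi.add_apply, add_mul, mul_add, map_add]; module)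
    (fun c x y => by
      ext i
      · simp; ring
      · simp only [Prod.smul_fst, Prod.smul_snd, Pi.smul_apply, smul_mul_assoc, mul_smul_comm,
          map_add, map_smul, smul_eq_mul]
        module)
    (fun x y y' => by
      ext i
      · simp; ring
      · simp only [Prod.fst_add, Prod.snd_add, Pi.add_apply, add_mul, mul_add, map_add]; module)
    (fun c x y => by
      ext i
      · simp; ring
      · simp only [Prod.smul_fst, Prod.smul_snd, Pi.smul_apply, smul_mul_assoc, mul_smul_comm,
          map_add, map_smul, smul_eq_mul]
        module)

lemma cr_fst (x y : O.Coord) (i : Fin 3) : (O.cr x y).1 i =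
    x.1 (i + 1) * y.1 (i + 2) + x.1 (i + 2) * y.1 (i + 1) - O.b (x.2 i) (y.2 i) := rfl

lemma cr_snd (x y : O.Coord) (i : Fin 3) : (O.cr x y).2 i =
    O.conj (x.2 (i + 1) * y.2 (i + 2) + y.2 (i + 1) * x.2 (i + 2))
      - x.1 i • y.2 i - y.1 i • x.2 i := rfl

/-- The trace form in coordinates. -/
def T : O.Coord →ₗ[F] O.Coord →ₗ[F] F :=
  LinearMap.mk₂ F (fun x y => ∑ i, (x.1 i * y.1 i + O.b (x.2 i) (y.2 i)))
    (fun x x' y => by rw [← Finset.sum_add_distrib]; congr 1; ext i; simp; ring)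
    (fun c x y => by rw [smul_eq_mul, Finset.mul_sum]; congr 1; ext i; simp; ring)
    (fun x y y' => by rw [← Finset.sum_add_distrib]; congr 1; ext i; simp; ring)
    (fun c x y => by rw [smul_eq_mul, Finset.mul_sum]; congr 1; ext i; simp; ring)

lemma T_apply (x y : O.Coord) : O.T x y = ∑ i, (x.1 i * y.1 i + O.b (x.2 i) (y.2 i)) := rfl

/-- The adjoint in coordinates. -/
def adj (x : O.Coord) : O.Coord :=
  (fun i => x.1 (i + 1) * x.1 (i + 2) - O.n (x.2 i),
    fun i => O.conj (x.2 (i + 1) * x.2 (i + 2)) - x.1 i • x.2 i)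

lemma adj_fst (x : O.Coord) (i : Fin 3) :
    (O.adj x).1 i = x.1 (i + 1) * x.1 (i + 2) - O.n (x.2 i) := rfl

lemma adj_snd (x : O.Coord) (i : Fin 3) :
    (O.adj x).2 i = O.conj (x.2 (i + 1) * x.2 (i + 2)) - x.1 i • x.2 i := rfl

/-- The cubic norm in coordinates. -/
def nrm (x : O.Coord) : F :=
  x.1 0 * x.1 1 * x.1 2 - (∑ j, x.1 j * O.n (x.2 j)) + O.b (O.conj (x.2 0 * x.2 1)) (x.2 2)

lemma nrm_eq (x : O.Coord) (i : Fin 3) : O.nrm x =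
    x.1 i * x.1 (i + 1) * x.1 (i + 2) - (x.1 i * O.n (x.2 i) + x.1 (i + 1) * O.n (x.2 (i + 1))
      + x.1 (i + 2) * O.n (x.2 (i + 2))) + O.b (O.conj (x.2 (i + 1) * x.2 (i + 2))) (x.2 i) := by
  have h1 := O.b_conj_mul_cyclic (x.2 0) (x.2 1) (x.2 2)
  have h2 := O.b_conj_mul_cyclic (x.2 2) (x.2 0) (x.2 1)
  rw [nrm, Fin.sum_univ_three]
  fin_cases i
  all_goals simp only [Fin.zero_eta, Fin.mk_one, Fin.reduceFinMk, Fin.isValue, Fin.reduceAdd]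
  · linear_combination h1 + h2
  · linear_combination h1
  · ring

lemma cr_self (x : O.Coord) : O.cr x x = (2 : F) • O.adj x := by
  ext i
  · rw [cr_fst, b_self]; simp [adj]; ring
  · rw [cr_snd, map_add]; simp only [adj, Prod.smul_snd, Pi.smul_apply]; module

lemma T_adj_self (x : O.Coord) : O.T (O.adj x) x = 3 * O.nrm x := by
  have h0 := O.nrm_eq x 0
  have h1 := O.nrm_eq x 1
  have h2 := O.nrm_eq x 2
  rw [T_apply, Fin.sum_univ_three]
  simp only [adj, map_sub, map_smul, LinearMap.sub_apply, LinearMap.smul_apply, smul_eq_mul, b_self]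
  simp only [Fin.isValue, Fin.reduceAdd] at h0 h1 h2 ⊢
  linear_combination (-1 : F) * (h0 + h1 + h2)

lemma adj_adj (x : O.Coord) : O.adj (O.adj x) = O.nrm x • x := by
  ext i
  · rw [Prod.smul_fst, Pi.smul_apply, smul_eq_mul, O.nrm_eq x i]
    have h : O.n (O.conj (x.2 (i + 1) * x.2 (i + 2)) - x.1 i • x.2 i)
        = O.n (x.2 (i + 1)) * O.n (x.2 (i + 2)) + x.1 i ^ 2 * O.n (x.2 i)
          - x.1 i * O.b (O.conj (x.2 (i + 1) * x.2 (i + 2))) (x.2 i) := by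
      rw [sub_eq_add_neg, ← neg_smul, n_add, n_smul, n_conj, O.n_mul, map_smul, smul_eq_mul]
      ring
    simp only [adj, h, fin_three_add_one_add_one, fin_three_add_one_add_two,
      fin_three_add_two_add_one, fin_three_add_two_add_two]
    ring
  · rw [Prod.smul_snd, Pi.smul_apply, O.nrm_eq x i]
    simp only [adj, fin_three_add_one_add_one, fin_three_add_one_add_two,
      fin_three_add_two_add_one, fin_three_add_two_add_two]
    generalize x.2 i = a, x.2 (i + 1) = c, x.2 (i + 2) = d
    generalize x.1 i = α, x.1 (i + 1) = β, x.1 (i + 2) = γ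
    have h1 := O.moufang a c d
    have h2 : (a * c) * O.conj c = O.n c • a := O.mul_mul_conj c a
    have h3 : O.conj d * (d * a) = O.n d • a := O.conj_mul_mul d a
    rw [O.conj_mul (O.conj (d * a) - β • c), map_sub, map_sub, map_smul, map_smul, conj_conj,
      conj_conj, sub_mul, mul_sub, mul_sub, smul_mul_assoc, mul_smul_comm, smul_mul_smul_comm, h1,
      h2, h3, ← O.conj_mul c d]
    module

end OctonionAlgebra

namespace OctonionAlgebra

variable {F : Type u} [Field F] (O : OctonionAlgebra.{u, v} F)

lemma cr_comm (x y : O.Coord) : O.cr x y = O.cr y x := by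
  ext i
  · rw [cr_fst, cr_fst, b_comm]; ring
  · rw [cr_snd, cr_snd, add_comm (x.2 (i + 1) * _)]; module

lemma T_comm (x y : O.Coord) : O.T x y = O.T y x := by
  simp only [T_apply, mul_comm, O.b_comm]

lemma T_cr (x y z : O.Coord) : O.T (O.cr x y) z = O.T x (O.cr y z) := by
  have h : ∀ i, O.b (x.2 i) (O.conj (y.2 (i + 1) * z.2 (i + 2)))
      = O.b (O.conj (x.2 i * y.2 (i + 1))) (z.2 (i + 2)) := fun i => by
    rw [b_comm, b_conj_mul_cyclic]
  have h' : ∀ i, O.b (x.2 i) (O.conj (z.2 (i + 1) * y.2 (i + 2)))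
      = O.b (O.conj (y.2 (i + 2) * x.2 i)) (z.2 (i + 1)) := fun i => by
    rw [b_comm, b_conj_mul_cyclic, b_conj_mul_cyclic]
  simp only [T_apply, Fin.sum_univ_three, cr_fst, cr_snd, map_add, map_sub, map_smul,
    LinearMap.add_apply, LinearMap.sub_apply, LinearMap.smul_apply, smul_eq_mul, h, h']
  simp only [Fin.isValue, Fin.reduceAdd]
  ring

/-- Two diagonal entries and the off-diagonal entry of the complementary `2 × 2` block. -/
def block (i : Fin 3) : (F × F × O.C) →ₗ[F] O.Coord where
  toFun p := (Pi.single (i + 1) p.1 + Pi.single (i + 2) p.2.1, Pi.single i p.2.2)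
  map_add' p q := by
    ext j
    · simp [Pi.single_add]; ring
    · simp [Pi.single_add]
  map_smul' c p := by
    ext j
    · simp [-smul_eq_mul, Pi.single_smul']
    · simp [Pi.single_smul']

lemma T_block (x : O.Coord) (i : Fin 3) (p : F × F × O.C) :
    O.T x (O.block i p) = x.1 (i + 1) * p.1 + x.1 (i + 2) * p.2.1 + O.b (x.2 i) p.2.2 := by
  rw [T_apply, Fin.sum_univ_three]
  fin_cases i <;> simp [block] <;> ring

lemma adj_block (i : Fin 3) (p : F × F × O.C) (hp : p.1 * p.2.1 = O.n p.2.2) :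
    O.adj (O.block i p) = 0 := by
  ext j
  · fin_cases i <;> fin_cases j <;> simp [adj, block, hp, Pi.single_apply]
  · fin_cases i <;> fin_cases j <;> simp [adj, block, Pi.single_apply]

lemma block_injective (i : Fin 3) : Function.Injective (O.block i) := by
  rw [injective_iff_map_eq_zero]
  intro p hp
  have h1 := congrFun (congrArg Prod.fst hp)
  have h2 := congrFun (congrArg Prod.snd hp)
  ext
  · have := h1 (i + 1); fin_cases i <;> simpa [block, Pi.single_apply] using this
  · have := h1 (i + 2); fin_cases i <;> simpa [block, Pi.single_apply] using this
  · have := h2 i; fin_cases i <;> simpa [block, Pi.single_apply] using this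

/-- The diagonal idempotents. -/
def idem (i : Fin 3) : O.Coord := (Pi.single i 1, 0)

lemma idem_eq (i : Fin 3) : O.idem (i + 1) = O.block i (1, 0, 0) := by
  ext j <;> simp [idem, block]

lemma cr_idem (i : Fin 3) (y : O.Coord) :
    O.cr (O.idem i) y = O.block i (y.1 (i + 2), y.1 (i + 1), -y.2 i) := by
  ext j
  · fin_cases i <;> fin_cases j <;> simp [cr_fst, block, idem]
  · fin_cases i <;> fin_cases j <;> simp [cr_snd, block, idem]

lemma finite : Module.Finite F O.C :=
  Module.finite_of_finrank_pos (by rw [O.finrank_eq]; norm_num)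

lemma finrank_range_cr_idem (i : Fin 3) :
    Module.finrank F (LinearMap.range (O.cr (O.idem i))) = 10 := by
  have := O.finite
  have h : LinearMap.range (O.cr (O.idem i)) = LinearMap.range (O.block i) := by
    apply le_antisymm
    · rintro _ ⟨y, rfl⟩
      exact ⟨_, (O.cr_idem i y).symm⟩
    · rintro _ ⟨p, rfl⟩
      refine ⟨O.block i (p.2.1, p.1, -p.2.2), ?_⟩
      rw [cr_idem]
      congr 1
      ext <;> fin_cases i <;> simp [block]
  rw [h, LinearMap.finrank_range_of_inj (O.block_injective i), Module.finrank_prod,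
    Module.finrank_prod, Module.finrank_self, O.finrank_eq]

lemma cr_self_eq_zero {x : O.Coord} (h : O.adj x = 0) : O.cr x x = 0 := by
  rw [cr_self, h, smul_zero]

lemma exists_rankOne_pair (x : O.Coord) (hx : x ≠ 0) : ∃ d e, O.cr d d = 0 ∧ O.T x d ≠ 0 ∧
    O.cr e e = 0 ∧ O.T d e ≠ 0 ∧ Module.finrank F (LinearMap.range (O.cr e)) = 10 := by
  have hidem : ∀ i, O.cr (O.idem (i + 1)) (O.idem (i + 1)) = 0 := fun i =>
    O.cr_self_eq_zero (by rw [idem_eq, adj_block _ _ _ (by simp)])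
  by_cases h : ∃ i, x.1 (i + 1) ≠ 0
  · obtain ⟨i, hi⟩ := h
    refine ⟨O.idem (i + 1), O.idem (i + 1), hidem i, ?_, hidem i, ?_, O.finrank_range_cr_idem _⟩
    · rw [idem_eq, T_block]; simpa using hi
    · rw [idem_eq, T_block]; simp [block]
  · push Not at h
    have h0 : x.1 = 0 := by
      ext i
      have := h (i + 2)
      rwa [fin_three_add_two_add_one] at this
    obtain ⟨i, hi⟩ : ∃ i, x.2 i ≠ 0 := by
      by_contra! hcon
      exact hx (Prod.ext h0 (funext hcon))
    obtain ⟨c, hc⟩ : ∃ c, O.b (x.2 i) c ≠ 0 := by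
      by_contra! hcon
      exact hi (O.nondeg _ hcon)
    refine ⟨O.block i (1, O.n c, c), O.idem (i + 1),
      O.cr_self_eq_zero (O.adj_block _ _ (one_mul _)), ?_, hidem i, ?_, O.finrank_range_cr_idem _⟩
    · rw [T_block, h0]; simpa using hc
    · rw [idem_eq, T_block]; fin_cases i <;> simp [block]

lemma quartic (h2 : (2 : F) ≠ 0) (h3 : (3 : F) ≠ 0) (x y u v : O.Coord) :
    O.cr (O.cr x y) (O.cr u v) + O.cr (O.cr x u) (O.cr y v) + O.cr (O.cr x v) (O.cr y u)
      = O.T (O.cr x y) u • v + O.T (O.cr x y) v • u + O.T (O.cr x u) v • y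
        + O.T (O.cr y u) v • x := by
  have hT : ∀ x y z, O.T (O.cr x y) z = O.T (O.cr x z) y := fun x y z => by
    rw [O.cr_comm x y, O.T_cr, O.T_comm]
  rw [← sub_eq_zero]
  refine eq_zero_of_diag_eq_zero h2 h3 (fun x y u v =>
    O.cr (O.cr x y) (O.cr u v) + O.cr (O.cr x u) (O.cr y v) + O.cr (O.cr x v) (O.cr y u)
      - (O.T (O.cr x y) u • v + O.T (O.cr x y) v • u + O.T (O.cr x u) v • y
        + O.T (O.cr y u) v • x)) ?_ ?_ ?_ ?_ ?_ x y u v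
  · intro x x' y u v
    simp only [map_add, LinearMap.add_apply]
    module
  · intro x y u v
    rw [O.cr_comm y x, O.cr_comm (O.cr y u), O.cr_comm (O.cr y v)]
    abel
  · intro x y u v
    rw [O.cr_comm u y, hT x u y]
    abel
  · intro x y u v
    rw [O.cr_comm v u, hT x v u, hT y v u]
    abel
  · intro x
    have h : O.cr (O.cr x x) (O.cr x x) = (8 * O.nrm x) • x := by
      rw [O.cr_self (O.cr x x), O.cr_self x]
      have : O.adj ((2 : F) • O.adj x) = (4 : F) • O.adj (O.adj x) := by
        have h := O.cr_self ((2 : F) • O.adj x)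
        rw [map_smul, map_smul, LinearMap.smul_apply, O.cr_self (O.adj x)] at h
        refine smul_right_injective _ h2 ?_
        dsimp only
        rw [← h]
        module
      rw [this, O.adj_adj]
      module
    have h' : O.T (O.cr x x) x = 6 * O.nrm x := by
      rw [O.cr_self, map_smul, LinearMap.smul_apply, T_adj_self, smul_eq_mul]; ring
    rw [h, h']
    module

/-- The cubic space of hermitian `3 × 3` matrices. -/
def cubicSpace (h2 : (2 : F) ≠ 0) (h3 : (3 : F) ≠ 0) : CubicSpace F O.Coord where
  cr := O.cr
  T := O.T
  two_ne := h2
  three_ne := h3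
  cr_comm := O.cr_comm
  T_comm := O.T_comm
  T_nondeg x hx := by
    by_contra h
    obtain ⟨d, -, -, hd, -⟩ := O.exists_rankOne_pair x h
    exact hd (hx d)
  T_cr := O.T_cr
  quartic := O.quartic h2 h3
  finrank_eq := by
    have := O.finite
    rw [Module.finrank_prod, Module.finrank_fin_fun, Module.finrank_pi_fintype]
    simp [O.finrank_eq]
  exists_rankOne_pair := O.exists_rankOne_pair

end OctonionAlgebra

namespace ReducedAlbert

variable {F : Type u} [Field F] (A : ReducedAlbert.{u, v} F)

/-- The hermitian matrix with the given coordinates. -/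
def ofCoord : A.O.Coord →ₗ[F] A.M where
  toFun x := Matrix.of
    ![![x.1 0 • (1 : A.O.C), x.2 2, A.O.conj (x.2 1)],
      ![A.O.conj (x.2 2), x.1 1 • (1 : A.O.C), x.2 0],
      ![x.2 1, A.O.conj (x.2 0), x.1 2 • (1 : A.O.C)]]
  map_add' x y := by
    ext i j
    fin_cases i <;> fin_cases j <;> simp [add_smul]
  map_smul' c x := by
    ext i j
    fin_cases i <;> fin_cases j <;> simp [mul_smul]

lemma ofCoord_apply (x : A.O.Coord) : A.ofCoord x = Matrix.of
    ![![x.1 0 • (1 : A.O.C), x.2 2, A.O.conj (x.2 1)],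
      ![A.O.conj (x.2 2), x.1 1 • (1 : A.O.C), x.2 0],
      ![x.2 1, A.O.conj (x.2 0), x.1 2 • (1 : A.O.C)]] := rfl

lemma trace_eq (x : A.M) : A.trace x = (2 : F)⁻¹ * ∑ i, A.O.b (x i i) 1 := rfl

lemma trace_ofCoord (h2 : (2 : F) ≠ 0) (x : A.O.Coord) :
    A.trace (A.ofCoord x) = x.1 0 + x.1 1 + x.1 2 := by
  rw [trace_eq, Fin.sum_univ_three]
  simp [ofCoord_apply, A.O.b_one_one]
  field_simp

lemma tb_ofCoord (h2 : (2 : F) ≠ 0) (x y : A.O.Coord) :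
    A.tb (A.ofCoord x) (A.ofCoord y) = A.O.T x y := by
  have h : ∀ a c, A.O.b (a * A.O.conj c) 1 = A.O.b a c := fun a c => by
    rw [A.O.b_mul_right_conj, A.O.conj_conj, one_mul]
  have h' : ∀ a c, A.O.b (A.O.conj a * c) 1 = A.O.b a c := fun a c => by
    rw [A.O.b_mul_left_conj, A.O.conj_conj, mul_one, A.O.b_comm]
  rw [tb, trace_eq, Fin.sum_univ_three, A.O.T_apply, Fin.sum_univ_three]
  simp [ofCoord_apply, jmul, A.O.b_one_one, h, h']
  rw [A.O.b_comm (y.2 0), A.O.b_comm (y.2 1), A.O.b_comm (y.2 2)]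
  field_simp
  ring

lemma sharp_ofCoord (h2 : (2 : F) ≠ 0) (x : A.O.Coord) :
    A.sharp (A.ofCoord x) = A.ofCoord (A.O.adj x) := by
  have hj : ∀ z : A.M, A.jmul z z = z * z := fun z => by
    rw [jmul, ← two_smul F, smul_smul, inv_mul_cancel₀ h2, one_smul]
  rw [sharp, tb_ofCoord A h2, trace_ofCoord A h2, hj, A.O.T_apply, Fin.sum_univ_three]
  have hq : (2 : F)⁻¹ * ((x.1 0 + x.1 1 + x.1 2) ^ 2 - (x.1 0 * x.1 0 + A.O.b (x.2 0) (x.2 0)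
      + (x.1 1 * x.1 1 + A.O.b (x.2 1) (x.2 1)) + (x.1 2 * x.1 2 + A.O.b (x.2 2) (x.2 2))))
      = x.1 0 * x.1 1 + x.1 1 * x.1 2 + x.1 2 * x.1 0
        - (A.O.n (x.2 0) + A.O.n (x.2 1) + A.O.n (x.2 2)) := by
    simp only [A.O.b_self]
    field_simp
    ring
  rw [hq]
  ext i j
  fin_cases i <;> fin_cases j <;>
    simp [ofCoord_apply, A.O.adj_fst, A.O.adj_snd, A.O.mul_conj, A.O.conj_mul_self,
      A.O.conj_mul] <;> module

lemma cross_ofCoord (h2 : (2 : F) ≠ 0) (x y : A.O.Coord) :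
    A.cross (A.ofCoord x) (A.ofCoord y) = A.ofCoord (A.O.cr x y) := by
  rw [cross, ← map_add, sharp_ofCoord A h2, sharp_ofCoord A h2, sharp_ofCoord A h2, ← map_sub,
    ← map_sub]
  congr 1
  have h := A.O.cr_self (x + y)
  simp only [map_add, LinearMap.add_apply] at h
  rw [A.O.cr_self,
    A.O.cr_self, A.O.cr_comm y x] at h
  refine smul_right_injective _ h2 ?_
  linear_combination (norm := module) -h

lemma ofCoord_injective : Function.Injective A.ofCoord := by
  rw [injective_iff_map_eq_zero]
  intro x hx
  have h : ∀ i j, A.ofCoord x i j = 0 := fun i j => congrFun (congrFun hx i) j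
  have h1 : (1 : A.O.C) ≠ 0 := fun h => by
    have := A.O.n_one
    rw [h, QuadraticMap.map_zero] at this
    exact zero_ne_one this
  ext i
  · have := h i i
    fin_cases i <;> simpa [ofCoord_apply, h1] using this
  · have := h (i + 1) (i + 2)
    fin_cases i <;> simpa [ofCoord_apply] using this

lemma range_ofCoord (h2 : (2 : F) ≠ 0) (hγ : ∀ i, A.γ i = 1) :
    LinearMap.range A.ofCoord = A.J := by
  ext z
  have hJ : z ∈ A.J ↔ ∀ i j, z i j = A.O.conj (z j i) := by
    change (∀ i j, z i j = ((A.γ i : F)⁻¹ * (A.γ j : F)) • A.O.conj (z j i)) ↔ _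
    simp [hγ]
  rw [hJ]
  constructor
  · rintro ⟨x, rfl⟩ i j
    fin_cases i <;> fin_cases j <;> simp [ofCoord_apply]
  · intro h
    refine ⟨(fun i => (2 : F)⁻¹ * A.O.b (z i i) 1, fun i => z (i + 1) (i + 2)), ?_⟩
    have hd : ∀ i, ((2 : F)⁻¹ * A.O.b (z i i) 1) • (1 : A.O.C) = z i i := fun i => by
      rw [mul_smul, ← A.O.add_conj, ← h i i, ← two_smul F, smul_smul, inv_mul_cancel₀ h2,
        one_smul]
    ext i j
    fin_cases i <;> fin_cases j <;> simp [ofCoord_apply, hd, ← h]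

end ReducedAlbert

namespace ReducedAlbert

variable {F : Type u} [Field F] (A : ReducedAlbert.{u, v} F) (h2 : (2 : F) ≠ 0) (h3 : (3 : F) ≠ 0)


/-- The cubic space of coordinates of `A`. -/
abbrev cub : CubicSpace F A.O.Coord := A.O.cubicSpace h2 h3

variable {A}

lemma ofCoord_mem (x : A.O.Coord) (h2 : (2 : F) ≠ 0) (hγ : ∀ i, A.γ i = 1) : A.ofCoord x ∈ A.J :=
  A.range_ofCoord h2 hγ ▸ LinearMap.mem_range_self A.ofCoord x

lemma exists_ofCoord_eq {z : A.M} (h2 : (2 : F) ≠ 0) (hγ : ∀ i, A.γ i = 1) (hz : z ∈ A.J) :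
    ∃ x, A.ofCoord x = z := by
  rwa [← A.range_ofCoord h2 hγ] at hz

lemma ofCoord_eq_zero {x : A.O.Coord} : A.ofCoord x = 0 ↔ x = 0 :=
  map_eq_zero_iff _ A.ofCoord_injective

lemma sharp_ofCoord_eq_zero {x : A.O.Coord} :
    A.sharp (A.ofCoord x) = 0 ↔ (A.cub h2 h3).cr x x = 0 := by
  change _ ↔ A.O.cr x x = 0
  rw [A.sharp_ofCoord h2, ofCoord_eq_zero, A.O.cr_self, smul_eq_zero, or_iff_right h2]

lemma brok_ofCoord_eq_zero (h2 : (2 : F) ≠ 0) {x y z : A.O.Coord} :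
    A.brok (A.ofCoord x) (A.ofCoord y) (A.ofCoord z) = 0 ↔
      A.O.cr y (A.O.cr x z) = A.O.T z y • x + ((3 : F)⁻¹ * A.O.T x y) • z := by
  rw [brok, A.cross_ofCoord h2, A.cross_ofCoord h2, A.tb_ofCoord h2, A.tb_ofCoord h2, ← map_smul,
    ← map_smul, ← map_sub, ← map_sub, ← map_smul, ofCoord_eq_zero, smul_eq_zero,
    or_iff_right (inv_ne_zero h2), sub_sub, sub_eq_zero]

lemma finrank_map_ofCoord (W : Submodule F A.O.Coord) :
    Module.finrank F (W.map A.ofCoord) = Module.finrank F W :=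
  (LinearEquiv.finrank_eq (Submodule.equivMapOfInjective _ A.ofCoord_injective W)).symm


lemma dualSet_map (hγ : ∀ i, A.γ i = 1) (W : Submodule F A.O.Coord) :
    A.dualSet (W.map A.ofCoord : Submodule F A.M)
      = (((A.cub h2 h3).dual W).map A.ofCoord : Submodule F A.M) := by
  ext j
  constructor
  · rintro ⟨hj, h⟩
    obtain ⟨y, rfl⟩ := exists_ofCoord_eq h2 hγ hj
    exact ⟨y, fun w hw z => (brok_ofCoord_eq_zero h2).1
      (h _ ⟨w, hw, rfl⟩ _ (ofCoord_mem z h2 hγ)), rfl⟩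
  · rintro ⟨y, hy, rfl⟩
    refine ⟨ofCoord_mem y h2 hγ, ?_⟩
    rintro _ ⟨w, hw, rfl⟩ z hz
    obtain ⟨z, rfl⟩ := exists_ofCoord_eq h2 hγ hz
    exact (brok_ofCoord_eq_zero h2).2 (hy w hw z)

lemma isTS_map (hγ : ∀ i, A.γ i = 1) {W : Submodule F A.O.Coord} :
    A.IsTS (W.map A.ofCoord) ↔ (A.cub h2 h3).TS W := by
  constructor
  · intro h w hw
    exact (sharp_ofCoord_eq_zero h2 h3).1 (h.2 _ ⟨w, hw, rfl⟩)
  · intro h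
    refine ⟨?_, ?_⟩
    · rintro _ ⟨w, -, rfl⟩
      exact ofCoord_mem w h2 hγ
    · rintro _ ⟨w, hw, rfl⟩
      exact (sharp_ofCoord_eq_zero h2 h3).2 (h w hw)

lemma IsTS.exists_eq_map (hγ : ∀ i, A.γ i = 1) {W : Submodule F A.M} (h : A.IsTS W) :
    ∃ U, (A.cub h2 h3).TS U ∧ U.map A.ofCoord = W := by
  have hW : (W.comap A.ofCoord).map A.ofCoord = W :=
    Submodule.map_comap_eq_of_le (h.1.trans (A.range_ofCoord h2 hγ).ge)
  exact ⟨_, (isTS_map h2 h3 hγ).1 (hW.symm ▸ h), hW⟩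

lemma isMaxTS_map (hγ : ∀ i, A.γ i = 1) {W : Submodule F A.O.Coord} :
    A.IsMaxTS (W.map A.ofCoord) ↔ (A.cub h2 h3).MaxTS W := by
  refine and_congr (isTS_map h2 h3 hγ) ⟨fun h U hU hle => ?_, fun h U hU hle => ?_⟩
  · exact Submodule.map_injective_of_injective A.ofCoord_injective
      (h _ ((isTS_map h2 h3 hγ).2 hU) (Submodule.map_mono hle))
  · obtain ⟨U, hU', rfl⟩ := hU.exists_eq_map h2 h3 hγ
    rw [h U hU' ((Submodule.map_le_map_iff_of_injective A.ofCoord_injective _ _).1 hle)]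

lemma cross_ofCoord_image (hγ : ∀ i, A.γ i = 1) (d : A.O.Coord) :
    {x : A.M | ∃ k ∈ A.J, x = A.cross (A.ofCoord d) k}
      = (((A.cub h2 h3).hyper d).map A.ofCoord : Submodule F A.M) := by
  ext x
  constructor
  · rintro ⟨k, hk, rfl⟩
    obtain ⟨k, rfl⟩ := exists_ofCoord_eq h2 hγ hk
    exact ⟨_, ⟨k, rfl⟩, (A.cross_ofCoord h2 d k).symm⟩
  · rintro ⟨_, ⟨k, rfl⟩, rfl⟩
    exact ⟨_, ofCoord_mem k h2 hγ, (A.cross_ofCoord h2 d k).symm⟩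

lemma exists_rankOne_ofCoord (hγ : ∀ i, A.γ i = 1) {d : A.M} (hd : d ∈ A.J) (hd0 : d ≠ 0)
    (hs : A.sharp d = 0) :
    ∃ x ≠ 0, (A.cub h2 h3).cr x x = 0 ∧ A.ofCoord x = d := by
  obtain ⟨x, rfl⟩ := exists_ofCoord_eq h2 hγ hd
  exact ⟨x, fun h => hd0 (ofCoord_eq_zero.2 h), (sharp_ofCoord_eq_zero h2 h3).1 hs, rfl⟩

lemma IsHyperline.exists_eq_map (hγ : ∀ i, A.γ i = 1) {H : Submodule F A.M} (h : A.IsHyperline H) :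
    ∃ x ≠ 0, (A.cub h2 h3).cr x x = 0 ∧ ((A.cub h2 h3).hyper x).map A.ofCoord = H := by
  obtain ⟨d, hd, hd0, hs, hH⟩ := h
  obtain ⟨x, hx0, hx, rfl⟩ := exists_rankOne_ofCoord h2 h3 hγ hd hd0 hs
  exact ⟨x, hx0, hx, SetLike.coe_injective ((cross_ofCoord_image h2 h3 hγ x).symm.trans hH.symm)⟩

lemma isHyperline_map (hγ : ∀ i, A.γ i = 1) {x : A.O.Coord} (hx0 : x ≠ 0)
    (hx : (A.cub h2 h3).cr x x = 0) :
    A.IsHyperline (((A.cub h2 h3).hyper x).map A.ofCoord) :=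
  ⟨A.ofCoord x, ofCoord_mem x h2 hγ, fun h => hx0 (ofCoord_eq_zero.1 h),
    (sharp_ofCoord_eq_zero h2 h3).2 hx, (cross_ofCoord_image h2 h3 hγ x).symm⟩

lemma map_span_singleton (x : A.O.Coord) :
    (Submodule.span F {x}).map A.ofCoord = Submodule.span F {A.ofCoord x} := by
  rw [Submodule.map_span, Set.image_singleton]

end ReducedAlbert

/-- **the duality lemma.**  Over a separably closed field, the map
`Φ(W) = {j ∈ J : ⟨w,j⟩ = 0 ∀ w ∈ W}` induces mutually inverse bijections between
(a) 3-dimensional totally singular subspaces and themselves, (b) 2-dimensional totally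
singular subspaces and 5-dimensional maximal totally singular subspaces, and (c)
1-dimensional totally singular subspaces and hyperlines, with `Φ(F·d) = d × J`.
In particular `d × J = d' × J` implies `F·d = F·d'`. -/
theorem stmt15 {F : Type u} [Field F] [IsSepClosed F] (h2 : (2 : F) ≠ 0) (h3 : (3 : F) ≠ 0)
    (A : ReducedAlbert.{u, v} F) (hA : A.IsSplitAlbert) :
    -- (a) 3-dimensional totally singular subspaces ↔ 3-dimensional totally singular ones
    ((∀ W : Submodule F A.M, A.IsTS W → Module.finrank F W = 3 →
        ∃ W' : Submodule F A.M, A.IsTS W' ∧ Module.finrank F W' = 3 ∧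
          A.dualSet (W : Set A.M) = (W' : Set A.M)) ∧
      (∀ W : Submodule F A.M, A.IsTS W → Module.finrank F W = 3 →
        A.dualSet (A.dualSet (W : Set A.M)) = (W : Set A.M))) ∧
    -- (b) 2-dimensional totally singular ↔ 5-dimensional maximal totally singular
    ((∀ W : Submodule F A.M, A.IsTS W → Module.finrank F W = 2 →
        ∃ W' : Submodule F A.M, A.IsMaxTS W' ∧ Module.finrank F W' = 5 ∧
          A.dualSet (W : Set A.M) = (W' : Set A.M)) ∧
      (∀ W' : Submodule F A.M, A.IsMaxTS W' → Module.finrank F W' = 5 →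
        ∃ W : Submodule F A.M, A.IsTS W ∧ Module.finrank F W = 2 ∧
          A.dualSet (W' : Set A.M) = (W : Set A.M)) ∧
      (∀ W : Submodule F A.M, A.IsTS W → Module.finrank F W = 2 →
        A.dualSet (A.dualSet (W : Set A.M)) = (W : Set A.M)) ∧
      (∀ W' : Submodule F A.M, A.IsMaxTS W' → Module.finrank F W' = 5 →
        A.dualSet (A.dualSet (W' : Set A.M)) = (W' : Set A.M))) ∧
    -- (c) 1-dimensional totally singular ↔ hyperlines, with Φ(F·d) = d × J
    ((∀ W : Submodule F A.M, A.IsTS W → Module.finrank F W = 1 →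
        ∃ H : Submodule F A.M, A.IsHyperline H ∧ A.dualSet (W : Set A.M) = (H : Set A.M)) ∧
      (∀ d ∈ A.J, d ≠ 0 → A.sharp d = 0 →
        A.dualSet ((Submodule.span F {d} : Submodule F A.M) : Set A.M)
          = {x : A.M | ∃ k ∈ A.J, x = A.cross d k}) ∧
      (∀ H : Submodule F A.M, A.IsHyperline H →
        ∃ W : Submodule F A.M, A.IsTS W ∧ Module.finrank F W = 1 ∧
          A.dualSet (H : Set A.M) = (W : Set A.M)) ∧
      (∀ W : Submodule F A.M, A.IsTS W → Module.finrank F W = 1 →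
        A.dualSet (A.dualSet (W : Set A.M)) = (W : Set A.M)) ∧
      (∀ H : Submodule F A.M, A.IsHyperline H →
        A.dualSet (A.dualSet (H : Set A.M)) = (H : Set A.M))) ∧
    -- in particular: d × J = d' × J implies F·d = F·d'
    (∀ d ∈ A.J, ∀ d' ∈ A.J, d ≠ 0 → d' ≠ 0 → A.sharp d = 0 → A.sharp d' = 0 →
      {x : A.M | ∃ k ∈ A.J, x = A.cross d k} = {x : A.M | ∃ k ∈ A.J, x = A.cross d' k} →
      (Submodule.span F {d} : Submodule F A.M) = Submodule.span F {d'}) := by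
  have hγ := hA.2
  refine ⟨⟨?_, ?_⟩, ⟨?_, ?_, ?_, ?_⟩, ⟨?_, ?_, ?_, ?_, ?_⟩, ?_⟩
  · intro W hW hr
    obtain ⟨U, hU, rfl⟩ := hW.exists_eq_map h2 h3 hγ
    rw [ReducedAlbert.finrank_map_ofCoord] at hr
    refine ⟨_, (ReducedAlbert.isTS_map h2 h3 hγ).2 (hU.dual (by omega)), ?_,
      ReducedAlbert.dualSet_map h2 h3 hγ U⟩
    rw [ReducedAlbert.finrank_map_ofCoord, hU.finrank_dual_three hr]
  · intro W hW hr
    obtain ⟨U, hU, rfl⟩ := hW.exists_eq_map h2 h3 hγ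
    rw [ReducedAlbert.finrank_map_ofCoord] at hr
    rw [ReducedAlbert.dualSet_map h2 h3 hγ, ReducedAlbert.dualSet_map h2 h3 hγ,
      hU.dual_dual_three hr]
  · intro W hW hr
    obtain ⟨U, hU, rfl⟩ := hW.exists_eq_map h2 h3 hγ
    rw [ReducedAlbert.finrank_map_ofCoord] at hr
    refine ⟨_, (ReducedAlbert.isMaxTS_map h2 h3 hγ).2 (hU.maxTS_dual hr), ?_,
      ReducedAlbert.dualSet_map h2 h3 hγ U⟩
    rw [ReducedAlbert.finrank_map_ofCoord, hU.finrank_dual_two hr]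
  · intro W hW hr
    obtain ⟨U, hU, rfl⟩ := hW.1.exists_eq_map h2 h3 hγ
    rw [ReducedAlbert.finrank_map_ofCoord] at hr
    have hM := (ReducedAlbert.isMaxTS_map h2 h3 hγ).1 hW
    refine ⟨_, (ReducedAlbert.isTS_map h2 h3 hγ).2 (hU.dual (by omega)), ?_,
      ReducedAlbert.dualSet_map h2 h3 hγ U⟩
    rw [ReducedAlbert.finrank_map_ofCoord, hM.finrank_dual hr]
  · intro W hW hr
    obtain ⟨U, hU, rfl⟩ := hW.exists_eq_map h2 h3 hγ
    rw [ReducedAlbert.finrank_map_ofCoord] at hr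
    rw [ReducedAlbert.dualSet_map h2 h3 hγ, ReducedAlbert.dualSet_map h2 h3 hγ,
      hU.dual_dual_two hr]
  · intro W hW hr
    obtain ⟨U, hU, rfl⟩ := hW.1.exists_eq_map h2 h3 hγ
    rw [ReducedAlbert.finrank_map_ofCoord] at hr
    have hM := (ReducedAlbert.isMaxTS_map h2 h3 hγ).1 hW
    rw [ReducedAlbert.dualSet_map h2 h3 hγ, ReducedAlbert.dualSet_map h2 h3 hγ, hM.dual_dual hr]
  · intro W hW hr
    obtain ⟨U, hU, rfl⟩ := hW.exists_eq_map h2 h3 hγ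
    rw [ReducedAlbert.finrank_map_ofCoord] at hr
    obtain ⟨x, hx0, hx, rfl⟩ := hU.exists_eq_span hr
    refine ⟨_, ReducedAlbert.isHyperline_map h2 h3 hγ hx0 hx, ?_⟩
    rw [ReducedAlbert.dualSet_map h2 h3 hγ, CubicSpace.dual_span_singleton hx hx0]
  · intro d hd hd0 hs
    obtain ⟨x, hx0, hx, rfl⟩ := ReducedAlbert.exists_rankOne_ofCoord h2 h3 hγ hd hd0 hs
    rw [ReducedAlbert.cross_ofCoord_image h2 h3 hγ, ← ReducedAlbert.map_span_singleton,
      ReducedAlbert.dualSet_map h2 h3 hγ, CubicSpace.dual_span_singleton hx hx0]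
  · intro H hH
    obtain ⟨x, hx0, hx, rfl⟩ := hH.exists_eq_map h2 h3 hγ
    refine ⟨_, (ReducedAlbert.isTS_map h2 h3 hγ).2 (CubicSpace.TS_span_singleton hx), ?_, ?_⟩
    · rw [ReducedAlbert.finrank_map_ofCoord, finrank_span_singleton hx0]
    · rw [ReducedAlbert.dualSet_map h2 h3 hγ, CubicSpace.dual_hyper hx hx0]
  · intro W hW hr
    obtain ⟨U, hU, rfl⟩ := hW.exists_eq_map h2 h3 hγ
    rw [ReducedAlbert.finrank_map_ofCoord] at hr
    obtain ⟨x, hx0, hx, rfl⟩ := hU.exists_eq_span hr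
    rw [ReducedAlbert.dualSet_map h2 h3 hγ, ReducedAlbert.dualSet_map h2 h3 hγ,
      CubicSpace.dual_span_singleton hx hx0, CubicSpace.dual_hyper hx hx0]
  · intro H hH
    obtain ⟨x, hx0, hx, rfl⟩ := hH.exists_eq_map h2 h3 hγ
    rw [ReducedAlbert.dualSet_map h2 h3 hγ, ReducedAlbert.dualSet_map h2 h3 hγ,
      CubicSpace.dual_hyper hx hx0, CubicSpace.dual_span_singleton hx hx0]
  · intro d hd d' hd' hd0 hd0' hs hs' h
    obtain ⟨x, hx0, hx, rfl⟩ := ReducedAlbert.exists_rankOne_ofCoord h2 h3 hγ hd hd0 hs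
    obtain ⟨y, hy0, hy, rfl⟩ := ReducedAlbert.exists_rankOne_ofCoord h2 h3 hγ hd' hd0' hs'
    rw [ReducedAlbert.cross_ofCoord_image h2 h3 hγ, ReducedAlbert.cross_ofCoord_image h2 h3 hγ]
      at h
    have hxy := Submodule.map_injective_of_injective A.ofCoord_injective (SetLike.coe_injective h)
    rw [← ReducedAlbert.map_span_singleton, ← ReducedAlbert.map_span_singleton,
      ← CubicSpace.dual_hyper hx hx0, ← CubicSpace.dual_hyper hy hy0, hxy]
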